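/- Let R₁ and R₂ be spherical residues of a building X. Then the interval [R₁,R₂] coincides with the pair {R₁,R₂} if and only if one of R₁, R₂ contains the other (R₁ ≤ R₂ or R₂ ≤ R₁) and no spherical residue other than R₁ and R₂ is sandwiched between them (i.e. every R with R₁ ≤ R ≤ R₂ or R₂ ≤ R ≤ R₁ satisfies R = R₁ or R = R₂). -/

import Mathlib

open Filter Topology

noncomputable section

variable {B : Type} {W : Type} [Group W] {M : CoxeterMatrix B}

/-- The subset `I` of the simple reflections is of *spherical type* if the standard
parabolic subgroup `W_I` it generates is finite. -/
def SphType (cs : CoxeterSystem M W) (I : Set B) : Prop :=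
  ((Subgroup.closure (cs.simple '' I) : Subgroup W) : Set W).Finite

/-- A building of type `(W,S)`, in the chamber-system (`W`-metric) approach:
a nonempty set of chambers with a Weyl-group-valued distance function `delta`. -/
structure Bldg (cs : CoxeterSystem M W) where
  Chamber : Type
  chamber_nonempty : Nonempty Chamber
  delta : Chamber → Chamber → W
  delta_eq_one_iff : ∀ C D, delta C D = 1 ↔ C = D
  delta_mem_pair : ∀ C D E (i : B), delta D E = cs.simple i →
    delta C E = delta C D * cs.simple i ∨ delta C E = delta C D
  delta_eq_of_length : ∀ C D E (i : B), delta D E = cs.simple i →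
    cs.length (delta C D * cs.simple i) = cs.length (delta C D) + 1 →
    delta C E = delta C D * cs.simple i
  exists_delta : ∀ C D (i : B), ∃ E, delta D E = cs.simple i ∧
    delta C E = delta C D * cs.simple i

namespace Bldg

variable {cs : CoxeterSystem M W} (X : Bldg cs)

instance : Nonempty X.Chamber := X.chamber_nonempty

instance : TopologicalSpace X.Chamber := ⊥
instance : DiscreteTopology X.Chamber := ⟨rfl⟩

/-- The gallery distance between two chambers. -/
def gdist (C D : X.Chamber) : ℕ := cs.length (X.delta C D)

/-- The `I`-residue of the chamber `C`. -/
def residue (I : Set B) (C : X.Chamber) : Set X.Chamber :=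
  {D | X.delta C D ∈ Subgroup.closure (cs.simple '' I)}

/-- `R` is a spherical residue. -/
def IsSphResidue (R : Set X.Chamber) : Prop :=
  ∃ (I : Set B) (C : X.Chamber), SphType cs I ∧ R = X.residue I C

/-- `R` is a panel, i.e. an `{s}`-residue. -/
def IsPanel (R : Set X.Chamber) : Prop :=
  ∃ (i : B) (C : X.Chamber), R = X.residue {i} C

/-- The set `Res(X)` of spherical residues of `X`. -/
def Res : Type := {R : Set X.Chamber // X.IsSphResidue R}

/-- The set of panels of `X`. -/
def Panel : Type := {R : Set X.Chamber // X.IsPanel R}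

instance : Nonempty X.Res := by
  obtain ⟨C⟩ := X.chamber_nonempty
  exact ⟨⟨X.residue ∅ C, ∅, C, by simp [SphType], rfl⟩⟩

instance : TopologicalSpace X.Res := ⊥
instance : DiscreteTopology X.Res := ⟨rfl⟩

/-- `R₁ ≤ R₂` : the spherical residue `R₂` contains `R₁`, i.e. `R₂ ⊆ R₁` as
sets of chambers. -/
def leRes (R₁ R₂ : X.Res) : Prop := R₂.1 ⊆ R₁.1

/-- The star `St(σ)` of a spherical residue. -/
def star (σ : X.Res) : Set X.Res := {τ | X.leRes σ τ}

/-- The gate (combinatorial projection) of the chamber `C` onto the residue `R` :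
the unique chamber of `R` through which pass minimal galleries from `C` to any
chamber of `R`. -/
def gate (R : Set X.Chamber) (C : X.Chamber) : X.Chamber :=
  Classical.epsilon fun D => D ∈ R ∧ ∀ E ∈ R, X.gdist C E = X.gdist C D + X.gdist D E

/-- The combinatorial projection of the residue `T` onto the residue `R`,
as a set of chambers. -/
def projSet (R T : Set X.Chamber) : Set X.Chamber := X.gate R '' T

/-- The combinatorial projection `proj_R(T)` of the spherical residue `T` onto
the spherical residue `R`, as a spherical residue. -/
def projRes (R T : X.Res) : X.Res :=
  Classical.epsilon fun U : X.Res => U.1 = X.projSet R.1 T.1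

/-- The map `proj_r : Res(X) → ∏_σ St(σ)` underlying the maximal combinatorial
bordification. -/
def projr (R : X.Res) : X.Res → X.Res := fun σ => X.projRes σ R

/-- The maximal combinatorial bordification `Cr(X)`: the closure of the image
of `proj_r`, each factor of the product being discrete. -/
def Cr : Set (X.Res → X.Res) := closure (Set.range X.projr)

/-- The map `proj_c : ch(X) → ∏_{σ panel} St(σ)` underlying the minimal
combinatorial bordification. -/
def projc (C : X.Chamber) : X.Panel → X.Chamber := fun σ => X.gate σ.1 C

/-- The minimal combinatorial bordification `Cc(X)`. -/
def Cc : Set (X.Panel → X.Chamber) := closure (Set.range X.projc)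

/-- A set of spherical residues is closed if it contains, with any residue,
all residues that it contains (in the order `leRes`). -/
def ClosedResSet (𝓡 : Set X.Res) : Prop :=
  ∀ R₁ R₂ : X.Res, X.leRes R₁ R₂ → R₂ ∈ 𝓡 → R₁ ∈ 𝓡

/-- A set of spherical residues is convex if it is closed and stable under
combinatorial projections. -/
def ConvexResSet (𝓡 : Set X.Res) : Prop :=
  X.ClosedResSet 𝓡 ∧ ∀ R₁ ∈ 𝓡, ∀ R₂ ∈ 𝓡, X.projRes R₁ R₂ ∈ 𝓡

/-- The closure of a set of spherical residues. -/
def resClosure (𝓡 : Set X.Res) : Set X.Res := ⋂₀ {𝓢 | X.ClosedResSet 𝓢 ∧ 𝓡 ⊆ 𝓢}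

/-- The convex hull of a set of spherical residues. -/
def convHull (𝓡 : Set X.Res) : Set X.Res := ⋂₀ {𝓢 | X.ConvexResSet 𝓢 ∧ 𝓡 ⊆ 𝓢}

/-- The convex hull `Conv(R₁,R₂)` of two spherical residues. -/
def conv2 (R₁ R₂ : X.Res) : Set X.Res := X.convHull {R₁, R₂}

/-- `α : W → ch(X)` is an apartment map: an isometric embedding of the Coxeter
complex. -/
def IsApartMap (α : W → X.Chamber) : Prop :=
  Function.Injective α ∧ ∀ v w : W, X.delta (α v) (α w) = v⁻¹ * w

/-- `A` is an apartment of `X`. -/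
def IsApartment (A : Set X.Chamber) : Prop :=
  ∃ α : W → X.Chamber, X.IsApartMap α ∧ A = Set.range α

/-- The residue `R` lies in the apartment `A`. -/
def LiesIn (R : X.Res) (A : Set X.Chamber) : Prop := (R.1 ∩ A).Nonempty

/-- `φ` is a root (half-apartment) of the apartment `A`. -/
def IsRootOf (A φ : Set X.Chamber) : Prop :=
  ∃ α : W → X.Chamber, X.IsApartMap α ∧ A = Set.range α ∧
    ∃ t : W, cs.IsReflection t ∧ φ = α '' {v : W | cs.length v < cs.length (t * v)}

/-- The residue `R` is contained in the root `φ` of the apartment `A`. -/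
def ContainedInRoot (R : X.Res) (A φ : Set X.Chamber) : Prop := R.1 ∩ A ⊆ φ

/-- `Φ_A(R₁,R₂)`: the set of roots of `A` containing `R₁` but not `R₂`. -/
def PhiSep (A : Set X.Chamber) (R₁ R₂ : X.Res) : Set (Set X.Chamber) :=
  {φ | X.IsRootOf A φ ∧ X.ContainedInRoot R₁ A φ ∧ ¬ X.ContainedInRoot R₂ A φ}

/-- A choice of apartment in which both `R₁` and `R₂` lie. -/
def chooseApt (R₁ R₂ : X.Res) : Set X.Chamber :=
  Classical.epsilon fun A : Set X.Chamber => X.IsApartment A ∧ X.LiesIn R₁ A ∧ X.LiesIn R₂ A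

/-- The root-distance between two spherical residues:
`d(R₁,R₂) = ½|Φ_A(R₁,R₂)| + ½|Φ_A(R₂,R₁)|` for an apartment `A` containing both. -/
def rootDist (R₁ R₂ : X.Res) : ℝ :=
  (((X.PhiSep (X.chooseApt R₁ R₂) R₁ R₂).ncard +
    (X.PhiSep (X.chooseApt R₁ R₂) R₂ R₁).ncard : ℕ) : ℝ) / 2

/-- The interval `[R₁,R₂]` determined by two spherical residues. -/
def interval (R₁ R₂ : X.Res) : Set X.Res :=
  {σ | X.rootDist R₁ R₂ = X.rootDist R₁ σ + X.rootDist σ R₂}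

/-- The retraction onto the apartment given by the apartment map `α`, centred at
the chamber `α 1`. -/
def retr (α : W → X.Chamber) (D : X.Chamber) : X.Chamber := α (X.delta (α 1) D)

/-- The retraction onto an apartment, acting on spherical residues: it maps the
`I`-residue of a chamber `D` to the `I`-residue of the retracted chamber. -/
def retrRes (α : W → X.Chamber) (R : X.Res) : X.Res :=
  Classical.epsilon fun T : X.Res =>
    ∃ (I : Set B) (D : X.Chamber), R.1 = X.residue I D ∧ T.1 = X.residue I (X.retr α D)

/-- The sequence `(R_n)` of spherical residues converges to `ξ` in the maximal
combinatorial bordification. -/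
def ConvSeq (ξ : X.Res → X.Res) (R : ℕ → X.Res) : Prop :=
  Tendsto (fun n => X.projr (R n)) atTop (nhds ξ)

/-- `Q(x, (R_n)) = ⋃_k ⋂_{n ≥ k} Conv(x, R_n)`. -/
def Qseq (x : X.Res) (R : ℕ → X.Res) : Set X.Res :=
  ⋃ k : ℕ, ⋂ n : ℕ, ⋂ _ : k ≤ n, X.conv2 x (R n)

/-- The combinatorial sector `Q(x,ξ)` based at `x` and pointing towards `ξ`. -/
def Qsector (x : X.Res) (ξ : X.Res → X.Res) : Set X.Res :=
  X.Qseq x (Classical.epsilon (X.ConvSeq ξ))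

/-- `Φ_A(ξ)`: the set of roots of the apartment `A` (with apartment map `α`) in
which every sequence of residues converging to `ξ`, retracted to `A`, eventually
lies. -/
def PhiXi (A : Set X.Chamber) (α : W → X.Chamber) (ξ : X.Res → X.Res) :
    Set (Set X.Chamber) :=
  {φ | X.IsRootOf A φ ∧ ∀ R : ℕ → X.Res, X.ConvSeq ξ R →
    ∃ N : ℕ, ∀ n > N, X.ContainedInRoot (X.retrRes α (R n)) A φ}

/-- `Φ_A(x)`: the set of roots of `A` containing the residue `x`. -/
def PhiRes (A : Set X.Chamber) (x : X.Res) : Set (Set X.Chamber) :=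
  {φ | X.IsRootOf A φ ∧ X.ContainedInRoot x A φ}

/-- The spherical residue `x` is a chamber (an `∅`-residue). -/
def IsChamberRes (x : X.Res) : Prop :=
  ∃ C : X.Chamber, x.1 = X.residue (∅ : Set B) C

/-- The automorphism group of the building: all permutations of the chambers
preserving the Weyl distance. -/
def autGroup : Subgroup (Equiv.Perm X.Chamber) where
  carrier := {g | ∀ C D : X.Chamber, X.delta (g C) (g D) = X.delta C D}
  one_mem' := by intro C D; simp
  mul_mem' := by
    intro a b ha hb C D
    simp only [Equiv.Perm.mul_apply]
    rw [ha, hb]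
  inv_mem' := by
    intro a ha C D
    have := ha (a⁻¹ C) (a⁻¹ D)
    simpa using this.symm

/-- `Aut(X)` as a type. -/
abbrev Aut : Type := ↥X.autGroup

/-- The topology of pointwise convergence on `Aut(X)` (the chamber set being
discrete). -/
instance : TopologicalSpace X.Aut :=
  TopologicalSpace.induced
    (fun g : X.Aut => ((g : Equiv.Perm X.Chamber) : X.Chamber → X.Chamber)) inferInstance

/-- The action of an automorphism on spherical residues. -/
def actRes (g : X.Aut) (R : X.Res) : X.Res :=
  Classical.epsilon fun T : X.Res => T.1 = (g : Equiv.Perm X.Chamber) '' R.1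

/-- The action of an automorphism on panels. -/
def actPanel (g : X.Aut) (σ : X.Panel) : X.Panel :=
  haveI : Nonempty X.Panel := ⟨σ⟩
  Classical.epsilon fun τ : X.Panel => τ.1 = (g : Equiv.Perm X.Chamber) '' σ.1

/-- The action of `Aut(X)` on the maximal combinatorial bordification:
`(g·f)(σ) = g·f(g⁻¹σ)`. -/
def actCr (g : X.Aut) (f : X.Res → X.Res) : X.Res → X.Res :=
  fun σ => X.actRes g (f (X.actRes g⁻¹ σ))

/-- The action of `Aut(X)` on the minimal combinatorial bordification. -/
def actCc (g : X.Aut) (f : X.Panel → X.Chamber) : X.Panel → X.Chamber :=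
  fun σ => (g : Equiv.Perm X.Chamber) (f (X.actPanel g⁻¹ σ))

/-- The building is locally finite: `S` is finite and panels are finite. -/
def LocallyFinite : Prop :=
  Finite B ∧ ∀ R : Set X.Chamber, X.IsPanel R → R.Finite

/-- The building is thick: every panel contains at least three chambers. -/
def Thick : Prop := ∀ R : Set X.Chamber, X.IsPanel R → 3 ≤ R.ncard

/-- The subgroup `G ≤ Aut(X)` acts strongly transitively: transitively on pairs
`(C, A)` of a chamber contained in an apartment. -/
def StronglyTransitive (G : Subgroup X.Aut) : Prop :=
  ∀ (C C' : X.Chamber) (A A' : Set X.Chamber),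
    X.IsApartment A → C ∈ A → X.IsApartment A' → C' ∈ A' →
    ∃ g ∈ G, (g : Equiv.Perm X.Chamber) C = C' ∧ (g : Equiv.Perm X.Chamber) '' A = A'

end Bldg

/-- A topological group is amenable if there is a left-invariant mean on the
space of bounded continuous real-valued functions on it. -/
def IsAmenableGroup (H : Type*) [Group H] [TopologicalSpace H] : Prop :=
  ∃ m : BoundedContinuousFunction H ℝ →ₗ[ℝ] ℝ,
    m 1 = 1 ∧ (∀ f : BoundedContinuousFunction H ℝ, (∀ x, 0 ≤ f x) → 0 ≤ m f) ∧
    ∀ (g : H) (f₁ f₂ : BoundedContinuousFunction H ℝ),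
      (∀ x, f₂ x = f₁ (g * x)) → m f₂ = m f₁

/-- A subset `K` of a topological group is topologically locally finite if every
finite subset of `K` generates a subgroup with compact closure. -/
def IsTLFSet {H : Type*} [Group H] [TopologicalSpace H] (K : Set H) : Prop :=
  ∀ s : Finset H, (s : Set H) ⊆ K →
    IsCompact (closure ((Subgroup.closure (s : Set H) : Subgroup H) : Set H))

/-- The space of closed subgroups of a topological group. -/
def ChabautySpace (H : Type*) [Group H] [TopologicalSpace H] : Type _ :=
  {K : Subgroup H // IsClosed (K : Set H)}

instance {H : Type*} [Group H] [TopologicalSpace H] : Nonempty (ChabautySpace H) :=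
  ⟨⟨⊤, by rw [Subgroup.coe_top]; exact isClosed_univ⟩⟩

/-- The Chabauty topology on the space of closed subgroups. -/
instance {H : Type*} [Group H] [TopologicalSpace H] : TopologicalSpace (ChabautySpace H) :=
  TopologicalSpace.generateFrom
    ({s | ∃ K : Set H, IsCompact K ∧ s = {L : ChabautySpace H | (L.1 : Set H) ∩ K = ∅}} ∪
     {s | ∃ U : Set H, IsOpen U ∧ s = {L : ChabautySpace H | ((L.1 : Set H) ∩ U).Nonempty}})

namespace Bldg

variable {cs : CoxeterSystem M W} (X : Bldg cs)

/-- The stabiliser in `G` of a spherical residue, as a set. -/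
def gstab (G : Subgroup X.Aut) (R : X.Res) : Set ↥G :=
  {g : ↥G | X.actRes (g : X.Aut) R = R}

/-- The stabiliser in `G` of a spherical residue, as a closed subgroup of `G`. -/
def gstabC (G : Subgroup X.Aut) (R : X.Res) : ChabautySpace ↥G :=
  Classical.epsilon fun L : ChabautySpace ↥G => (L.1 : Set ↥G) = X.gstab G R

/-- `D_ξ`: the union over `x ∈ Res(X)` of the pointwise fixators in `G` of the
combinatorial sectors `Q(x,ξ)`. -/
def gfixSector (G : Subgroup X.Aut) (ξ : X.Res → X.Res) : Set ↥G :=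
  {g : ↥G | ∃ x : X.Res, ∀ R ∈ X.Qsector x ξ, X.actRes (g : X.Aut) R = R}

/-- `D_ξ` as a closed subgroup of `G` (an element of the Chabauty space). -/
def DxiC (G : Subgroup X.Aut) (ξ : X.Res → X.Res) : ChabautySpace ↥G :=
  Classical.epsilon fun L : ChabautySpace ↥G => (L.1 : Set ↥G) = X.gfixSector G ξ

/-- The set of periodic elements of the stabiliser `G_ξ`. -/
def periodicStab (G : Subgroup X.Aut) (ξ : X.Res → X.Res) : Set ↥G :=
  {g : ↥G | X.actCr (g : X.Aut) ξ = ξ ∧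
    IsCompact (closure ((Subgroup.zpowers g : Subgroup ↥G) : Set ↥G))}

/-- The horofunction compactification of the chamber graph, with base point `y₀`. -/
def horoCh (y₀ : X.Chamber) : Set (X.Chamber → ℝ) :=
  closure (Set.range fun C : X.Chamber =>
    fun y : X.Chamber => (X.gdist C y : ℝ) - (X.gdist C y₀ : ℝ))

/-- The horofunction compactification of `(Res(X), root-distance)`, with base
point `z₀`. -/
def horoRes (z₀ : X.Res) : Set (X.Res → ℝ) :=
  closure (Set.range fun R : X.Res =>
    fun y : X.Res => X.rootDist R y - X.rootDist R z₀)

/-- The action of `Aut(X)` on horofunctions of the chamber graph. -/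
def actHoroCh (y₀ : X.Chamber) (g : X.Aut) (h : X.Chamber → ℝ) : X.Chamber → ℝ :=
  fun y => h (((g⁻¹ : X.Aut) : Equiv.Perm X.Chamber) y) -
    h (((g⁻¹ : X.Aut) : Equiv.Perm X.Chamber) y₀)

/-- The action of `Aut(X)` on horofunctions of `(Res(X), root-distance)`. -/
def actHoroRes (z₀ : X.Res) (g : X.Aut) (h : X.Res → ℝ) : X.Res → ℝ :=
  fun y => h (X.actRes g⁻¹ y) - h (X.actRes g⁻¹ z₀)

end Bldg

open scoped Pointwise

namespace CoxeterSystem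

variable (cs : CoxeterSystem M W)

open Classical in
/-- The permutation of `W × ZMod 2` attached to a simple reflection `s`: conjugation by `s` on the
first factor, and a change of sign exactly over `s`. -/
def signedConj (i : B) : Equiv.Perm (W × ZMod 2) :=
  Function.Involutive.toPerm
    (fun p => (cs.simple i * p.1 * cs.simple i, p.2 + if p.1 = cs.simple i then 1 else 0)) <| by
    intro p
    have h : cs.simple i * p.1 * cs.simple i = cs.simple i ↔ p.1 = cs.simple i := by
      constructor
      · intro h
        have := congrArg (fun x => cs.simple i * x * cs.simple i) h
        simpa [mul_assoc] using this
      · intro h; simp [h]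
    ext
    · simp [mul_assoc]
    · simp only [h, add_assoc, CharTwo.add_self_eq_zero, add_zero]

open Classical in
theorem signedConj_apply (i : B) (p : W × ZMod 2) :
    cs.signedConj i p =
      (cs.simple i * p.1 * cs.simple i, p.2 + if p.1 = cs.simple i then 1 else 0) := rfl

open Classical in
theorem signedConj_mul_pow_apply (i j : B) (n : ℕ) (p : W × ZMod 2) :
    ((cs.signedConj i * cs.signedConj j) ^ n) p =
      ((cs.simple i * cs.simple j) ^ n * p.1 * ((cs.simple i * cs.simple j) ^ n)⁻¹,
        p.2 + ∑ k ∈ Finset.range (2 * n),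
          if (cs.simple i * cs.simple j) ^ k * p.1 = cs.simple j then 1 else 0) := by
  induction n with
  | zero => simp
  | succ n ih =>
    set r := cs.simple i * cs.simple j with hr
    have hrj : ∀ k : ℕ, cs.simple j * r ^ k = (r ^ k)⁻¹ * cs.simple j := by
      intro k
      induction k with
      | zero => simp
      | succ k ihk =>
        have h1 : cs.simple j * r = r⁻¹ * cs.simple j := by simp [hr, mul_assoc]
        rw [pow_succ, ← mul_assoc, ihk, mul_assoc, h1, ← mul_assoc, ← mul_inv_rev, ← pow_succ',
          pow_succ]
    have h1 : r ^ n * p.1 * (r ^ n)⁻¹ = cs.simple j ↔ r ^ (2 * n) * p.1 = cs.simple j := by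
      rw [mul_inv_eq_iff_eq_mul, hrj, eq_inv_mul_iff_mul_eq, ← mul_assoc, ← pow_add, two_mul]
    have h2 : cs.simple j * (r ^ n * p.1 * (r ^ n)⁻¹) * cs.simple j = cs.simple i ↔
        r ^ (2 * n + 1) * p.1 = cs.simple j := by
      rw [← eq_mul_inv_iff_mul_eq, cs.inv_simple, ← hr, ← eq_inv_mul_iff_mul_eq, cs.inv_simple,
        mul_inv_eq_iff_eq_mul, mul_assoc, ← pow_succ', hrj, eq_inv_mul_iff_mul_eq, ← mul_assoc,
        ← pow_add, show n + 1 + n = 2 * n + 1 by ring]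
    rw [pow_succ', Equiv.Perm.mul_apply, ih, Equiv.Perm.mul_apply, signedConj_apply,
      signedConj_apply]
    ext
    · simp [pow_succ', hr, mul_assoc]
    · simp only [show 2 * (n + 1) = 2 * n + 1 + 1 by ring, Finset.sum_range_succ, h1, h2]
      ring

theorem isLiftable_signedConj : M.IsLiftable cs.signedConj := by
  classical
  intro i j
  ext1 p
  rw [signedConj_mul_pow_apply, cs.simple_mul_simple_pow, two_mul, Finset.sum_range_add]
  simp [pow_add, cs.simple_mul_simple_pow, CharTwo.add_self_eq_zero]

/-- The action of `W` on `W × ZMod 2` by signed conjugation. -/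
def signedConjHom : W →* Equiv.Perm (W × ZMod 2) := cs.lift ⟨_, cs.isLiftable_signedConj⟩

/-- The sign change of `w` over `t`. -/
def signChange (w t : W) : ZMod 2 := (cs.signedConjHom w (t, 0)).2

open Classical in
theorem signedConjHom_wordProd_apply (ω : List B) (t : W) (e : ZMod 2) :
    cs.signedConjHom (cs.wordProd ω) (t, e) =
      (cs.wordProd ω * t * (cs.wordProd ω)⁻¹, e + ((cs.rightInvSeq ω).count t : ℕ)) := by
  induction ω with
  | nil => simp
  | cons i ω ih =>
    rw [cs.wordProd_cons, map_mul, Equiv.Perm.mul_apply, ih]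
    have : cs.signedConjHom (cs.simple i) = cs.signedConj i :=
      cs.lift_apply_simple cs.isLiftable_signedConj i
    rw [this, signedConj_apply]
    have h : cs.wordProd ω * t * (cs.wordProd ω)⁻¹ = cs.simple i ↔
        (cs.wordProd ω)⁻¹ * cs.simple i * cs.wordProd ω = t := by
      constructor
      · intro h; rw [← h]; group
      · intro h; rw [← h]; group
    ext
    · simp [mul_assoc]
    · simp [h, rightInvSeq, List.count_cons, add_assoc]

theorem signedConjHom_apply (w t : W) (e : ZMod 2) :
    cs.signedConjHom w (t, e) = (w * t * w⁻¹, e + cs.signChange w t) := by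
  obtain ⟨ω, rfl⟩ := cs.wordProd_surjective w
  simp [signChange, signedConjHom_wordProd_apply]

theorem signChange_mul (w u t : W) :
    cs.signChange (w * u) t = cs.signChange u t + cs.signChange w (u * t * u⁻¹) := by
  conv_lhs => rw [signChange, map_mul, Equiv.Perm.mul_apply, signedConjHom_apply,
    signedConjHom_apply]
  simp

theorem signChange_one (t : W) : cs.signChange 1 t = 0 := by simp [signChange]

theorem signChange_simple_self (i : B) : cs.signChange (cs.simple i) (cs.simple i) = 1 := by
  have : cs.signedConjHom (cs.simple i) = cs.signedConj i :=
    cs.lift_apply_simple cs.isLiftable_signedConj i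
  simp [signChange, this, signedConj_apply]

theorem signChange_self {t : W} (ht : cs.IsReflection t) : cs.signChange t t = 1 := by
  obtain ⟨w, i, rfl⟩ := ht
  have h := cs.signChange_mul w w⁻¹ (w * cs.simple i * w⁻¹)
  rw [mul_inv_cancel, signChange_one] at h
  have e1 : w⁻¹ * (w * cs.simple i * w⁻¹) * w⁻¹⁻¹ = cs.simple i := by group
  have e2 : cs.simple i * cs.simple i * (cs.simple i)⁻¹ = cs.simple i := by simp
  rw [e1] at h
  rw [signChange_mul, signChange_mul, e1, e2, signChange_simple_self]
  linear_combination -h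

theorem mem_rightInvSeq_of_signChange {ω : List B} {t : W}
    (h : cs.signChange (cs.wordProd ω) t ≠ 0) : t ∈ cs.rightInvSeq ω := by
  classical
  by_contra hc
  apply h
  simp [signChange, signedConjHom_wordProd_apply, List.count_eq_zero_of_not_mem hc]

theorem isRightInversion_of_signChange {w t : W} (h : cs.signChange w t ≠ 0) :
    cs.IsRightInversion w t := by
  obtain ⟨ω, hω, rfl⟩ := cs.exists_isReduced w
  exact cs.isRightInversion_of_mem_rightInvSeq hω (cs.mem_rightInvSeq_of_signChange h)

theorem isRightInversion_iff_signChange {w t : W} (ht : cs.IsReflection t) :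
    cs.IsRightInversion w t ↔ cs.signChange w t = 1 := by
  constructor
  · intro h
    by_contra hc
    have h0 : cs.signChange w t = 0 := by
      revert hc
      generalize cs.signChange w t = x
      revert x
      decide
    have h1 : cs.signChange (w * t) t = 1 := by
      rw [signChange_mul, signChange_self cs ht]
      simp [h0]
    have := (cs.isRightInversion_of_signChange (w := w * t) (t := t) (by simp [h1])).2
    rw [mul_assoc, ht.mul_self, mul_one] at this
    exact absurd h.2 (by omega)
  · intro h
    exact cs.isRightInversion_of_signChange (by simp [h])

/-- The inversions of a product form the twisted symmetric difference of the inversions of the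
factors. -/
theorem isLeftInversion_mul_iff {w u t : W} (ht : cs.IsReflection t) :
    cs.IsLeftInversion (w * u) t ↔
      ¬ (cs.IsLeftInversion w t ↔ cs.IsLeftInversion u (w⁻¹ * t * w)) := by
  have ht' : cs.IsReflection (w⁻¹ * t * w) := by simpa using ht.conj w⁻¹
  rw [← cs.isRightInversion_inv_iff, ← cs.isRightInversion_inv_iff, ← cs.isRightInversion_inv_iff,
    cs.isRightInversion_iff_signChange ht, cs.isRightInversion_iff_signChange ht,
    cs.isRightInversion_iff_signChange ht', mul_inv_rev, signChange_mul, inv_inv]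
  generalize cs.signChange w⁻¹ t = x
  generalize cs.signChange u⁻¹ (w⁻¹ * t * w) = y
  revert x y
  decide

theorem isLeftInversion_self {t : W} (ht : cs.IsReflection t) : cs.IsLeftInversion t t :=
  ⟨ht, by simpa [ht.mul_self] using ht.odd_length.pos⟩

/-- The strong exchange condition. -/
theorem exists_eraseIdx_of_isLeftInversion {ω : List B} {t : W}
    (h : cs.IsLeftInversion (cs.wordProd ω) t) :
    ∃ j < ω.length, t * cs.wordProd ω = cs.wordProd (ω.eraseIdx j) := by
  have h1 : t ∈ cs.rightInvSeq ω.reverse := by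
    apply cs.mem_rightInvSeq_of_signChange
    rw [← cs.isRightInversion_inv_iff, cs.isRightInversion_iff_signChange h.1] at h
    simp [h]
  rw [rightInvSeq_reverse, List.mem_reverse] at h1
  obtain ⟨j, hj, rfl⟩ := List.getElem_of_mem h1
  have := cs.getD_leftInvSeq_mul_wordProd ω j
  rw [List.getD_eq_getElem _ _ hj] at this
  exact ⟨j, by simpa using hj, this⟩

theorem finite_setOf_isLeftInversion (w : W) : {t | cs.IsLeftInversion w t}.Finite := by
  obtain ⟨ω, rfl⟩ := cs.wordProd_surjective w
  refine ((Set.finite_lt_nat ω.length).image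
    fun j => cs.wordProd (ω.eraseIdx j) * (cs.wordProd ω)⁻¹).subset ?_
  intro t ht
  obtain ⟨j, hj, h⟩ := cs.exists_eraseIdx_of_isLeftInversion ht
  exact ⟨j, hj, by simp [← h]⟩

end CoxeterSystem

namespace CoxeterSystem

variable (cs : CoxeterSystem M W)

/-- The standard parabolic subgroup of type `I`. -/
abbrev parabolic (I : Set B) : Subgroup W := Subgroup.closure (cs.simple '' I)

theorem simple_mem_parabolic {I : Set B} {i : B} (hi : i ∈ I) : cs.simple i ∈ cs.parabolic I :=
  Subgroup.subset_closure ⟨i, hi, rfl⟩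

theorem wordProd_mem_parabolic {I : Set B} {ω : List B} (h : ∀ i ∈ ω, i ∈ I) :
    cs.wordProd ω ∈ cs.parabolic I := by
  apply Subgroup.list_prod_mem
  simp only [List.mem_map, forall_exists_index, and_imp, forall_apply_eq_imp_iff₂]
  exact fun i hi => cs.simple_mem_parabolic (h i hi)

theorem exists_word_of_mem_parabolic {I : Set B} {w : W} (hw : w ∈ cs.parabolic I) :
    ∃ ω : List B, (∀ i ∈ ω, i ∈ I) ∧ cs.wordProd ω = w := by
  induction hw using Subgroup.closure_induction with
  | mem x hx =>
    obtain ⟨i, hi, rfl⟩ := hx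
    exact ⟨[i], by simpa using hi, by simp⟩
  | one => exact ⟨[], by simp, by simp⟩
  | mul x y _ _ hx hy =>
    obtain ⟨ω, h, rfl⟩ := hx
    obtain ⟨ω', h', rfl⟩ := hy
    exact ⟨ω ++ ω', by simpa [or_imp, forall_and] using ⟨h, h'⟩, cs.wordProd_append _ _⟩
  | inv x _ hx =>
    obtain ⟨ω, h, rfl⟩ := hx
    exact ⟨ω.reverse, by simpa using h, cs.wordProd_reverse _⟩

theorem exists_reduced_word_of_mem_parabolic {I : Set B} {w : W} (hw : w ∈ cs.parabolic I) :
    ∃ ω : List B, (∀ i ∈ ω, i ∈ I) ∧ cs.IsReduced ω ∧ cs.wordProd ω = w := by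
  obtain ⟨ω, hω, rfl⟩ := cs.exists_word_of_mem_parabolic hw
  clear hw
  induction h : ω.length using Nat.strong_induction_on generalizing ω with
  | _ n ih =>
    cases ω with
    | nil => exact ⟨[], by simp, by simp [IsReduced], rfl⟩
    | cons i ω =>
      obtain ⟨hi, hω⟩ := List.forall_mem_cons.1 hω
      obtain ⟨ω', hω', hr, he⟩ := ih ω.length (by simp [← h]) ω hω rfl
      have hl : ω'.length ≤ ω.length := by
        rw [← hr.eq, he]; exact cs.length_wordProd_le ω
      by_cases hd : cs.IsLeftInversion (cs.wordProd ω') (cs.simple i)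
      · obtain ⟨j, hj, e⟩ := cs.exists_eraseIdx_of_isLeftInversion hd
        have hlen := List.length_eraseIdx_of_lt hj
        obtain ⟨ω'', h1, h2, h3⟩ := ih (ω'.eraseIdx j).length (by simp at h; omega) (ω'.eraseIdx j)
          (fun k hk => hω' k (List.mem_of_mem_eraseIdx hk)) rfl
        exact ⟨ω'', h1, h2, by rw [h3, ← e, he, cs.wordProd_cons]⟩
      · refine ⟨i :: ω', List.forall_mem_cons.2 ⟨hi, hω'⟩, ?_, by
          rw [cs.wordProd_cons, cs.wordProd_cons, he]⟩
        rw [cs.isLeftInversion_simple_iff_isLeftDescent, cs.not_isLeftDescent_iff] at hd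
        rw [IsReduced, cs.wordProd_cons, hd, hr.eq, List.length_cons]

theorem mem_parabolic_of_isLeftInversion {I : Set B} {w t : W} (hw : w ∈ cs.parabolic I)
    (h : cs.IsLeftInversion w t) : t ∈ cs.parabolic I := by
  obtain ⟨ω, hω, rfl⟩ := cs.exists_word_of_mem_parabolic hw
  obtain ⟨j, -, e⟩ := cs.exists_eraseIdx_of_isLeftInversion h
  rw [eq_mul_inv_of_mul_eq e]
  exact mul_mem (cs.wordProd_mem_parabolic fun i hi => hω i (List.mem_of_mem_eraseIdx hi))
    (inv_mem hw)

/-- An element having every `i ∈ I` as a left descent has every element of `W_I` as a prefix. -/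
theorem length_eq_add_of_forall_isLeftDescent {I : Set B} {g u : W}
    (hg : ∀ i ∈ I, cs.IsLeftDescent g i) (hu : u ∈ cs.parabolic I) :
    cs.length g = cs.length u + cs.length (u⁻¹ * g) := by
  obtain ⟨ω, hω, hr, rfl⟩ := cs.exists_reduced_word_of_mem_parabolic hu
  clear hu
  induction ω with
  | nil => simp
  | cons i ω ih =>
    obtain ⟨hi, hω⟩ := List.forall_mem_cons.1 hω
    have hr' : cs.IsReduced ω := by simpa using hr.drop 1
    have ih := ih hω hr'
    set u := cs.wordProd ω
    have hlen : cs.length (cs.simple i * u) = cs.length u + 1 := by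
      rw [← cs.wordProd_cons, hr.eq, hr'.eq, List.length_cons]
    have hni : ¬ cs.IsLeftInversion u (cs.simple i) := by
      rw [cs.isLeftInversion_simple_iff_isLeftDescent, cs.not_isLeftDescent_iff, hlen]
    have hgi := (cs.isLeftInversion_simple_iff_isLeftDescent g i).2 (hg i hi)
    rw [← mul_inv_cancel_left u g, cs.isLeftInversion_mul_iff (cs.isReflection_simple i)] at hgi
    have h2 : cs.IsLeftInversion (u⁻¹ * g) (u⁻¹ * cs.simple i * u) := by tauto
    have h3 := h2.2
    have e : u⁻¹ * cs.simple i * u * (u⁻¹ * g) = (cs.simple i * u)⁻¹ * g := by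
      simp [mul_assoc]
    rw [e] at h3
    rw [cs.wordProd_cons]
    change cs.length g = cs.length (cs.simple i * u) + cs.length ((cs.simple i * u)⁻¹ * g)
    have h4 := cs.length_mul_le (cs.simple i * u) ((cs.simple i * u)⁻¹ * g)
    rw [mul_inv_cancel_left] at h4
    omega

theorem isLeftInversion_of_length_eq_add {g u t : W}
    (h : cs.length g = cs.length u + cs.length (u⁻¹ * g)) (ht : cs.IsLeftInversion u t) :
    cs.IsLeftInversion g t := by
  refine ⟨ht.1, ?_⟩
  have h1 := cs.length_mul_le (t * u) (u⁻¹ * g)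
  have h2 := ht.2
  rw [← mul_assoc, mul_inv_cancel_right] at h1
  omega

theorem eq_of_forall_isLeftInversion_iff {u v : W}
    (h : ∀ t, cs.IsLeftInversion u t ↔ cs.IsLeftInversion v t) : u = v := by
  by_contra hne
  have : u⁻¹ * v ≠ 1 := fun h => hne (inv_mul_eq_one.1 h)
  obtain ⟨i, hi⟩ := cs.exists_leftDescent_of_ne_one this
  rw [← cs.isLeftInversion_simple_iff_isLeftDescent] at hi
  have hr : cs.IsReflection (u * cs.simple i * u⁻¹) := (cs.isReflection_simple i).conj u
  have h1 := cs.isLeftInversion_mul_iff (w := u) (u := u⁻¹ * v) hr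
  rw [mul_inv_cancel_left, ← h,
    show u⁻¹ * (u * cs.simple i * u⁻¹) * u = cs.simple i by group] at h1
  tauto

theorem sphType_of_forall_isLeftDescent {I : Set B} {g : W}
    (hg : ∀ i ∈ I, cs.IsLeftDescent g i) : SphType cs I := by
  have hfin := (cs.finite_setOf_isLeftInversion g).finite_subsets
  refine Set.Finite.of_finite_image (f := fun u => {t | cs.IsLeftInversion u t})
    (hfin.subset ?_) ?_
  · rintro _ ⟨u, hu, rfl⟩ t ht
    exact cs.isLeftInversion_of_length_eq_add (cs.length_eq_add_of_forall_isLeftDescent hg hu) ht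
  · intro u _ v _ h
    exact cs.eq_of_forall_isLeftInversion_iff fun t => Set.ext_iff.1 h t

theorem exists_longest {I : Set B} (hI : SphType cs I) :
    ∃ w ∈ cs.parabolic I, ∀ t ∈ cs.parabolic I, cs.IsReflection t → cs.IsLeftInversion w t := by
  obtain ⟨w, hw, hmax⟩ := Set.exists_max_image _ cs.length hI ⟨1, one_mem (cs.parabolic I)⟩
  refine ⟨w, hw, fun t ht hr => ⟨hr, ?_⟩⟩
  exact lt_of_le_of_ne (hmax _ (mul_mem ht hw)) (hr.length_mul_right_ne w)

end CoxeterSystem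

/-- The half-spaces of the Coxeter complex. -/
def halfSpaces (cs : CoxeterSystem M W) : Set (Set W) :=
  {H | ∃ g t : W, cs.IsReflection t ∧ H = g • {v : W | cs.length v < cs.length (t * v)}}

namespace CoxeterSystem

variable (cs : CoxeterSystem M W)

theorem setOf_length_lt_eq {t : W} (ht : cs.IsReflection t) :
    {v : W | cs.length v < cs.length (t * v)} = {v | ¬ cs.IsLeftInversion v t} := by
  ext v
  have := ht.length_mul_right_ne v
  simp only [Set.mem_ofPred_eq, IsLeftInversion, ht, true_and]
  omega

theorem setOf_not_isLeftInversion_mem {t : W} (ht : cs.IsReflection t) :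
    {v | ¬ cs.IsLeftInversion v t} ∈ halfSpaces cs :=
  ⟨1, t, ht, by rw [one_smul, cs.setOf_length_lt_eq ht]⟩

theorem smul_mem_halfSpaces {H : Set W} (hH : H ∈ halfSpaces cs) (g : W) :
    g • H ∈ halfSpaces cs := by
  obtain ⟨a, t, ht, rfl⟩ := hH
  exact ⟨g * a, t, ht, by rw [mul_smul]⟩

theorem compl_mem_halfSpaces {H : Set W} (hH : H ∈ halfSpaces cs) : Hᶜ ∈ halfSpaces cs := by
  obtain ⟨a, t, ht, rfl⟩ := hH
  refine ⟨a * t, t, ht, ?_⟩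
  rw [mul_smul, ← Set.smul_set_compl]
  congr 1
  ext v
  have := ht.length_mul_right_ne v
  simp only [Set.mem_compl_iff, Set.mem_ofPred_eq, Set.mem_smul_set_iff_inv_smul_mem, ht.inv,
    smul_eq_mul, ← mul_assoc, ht.mul_self, one_mul]
  omega

theorem exists_reflection_of_mem_halfSpaces {H : Set W} (hH : H ∈ halfSpaces cs) (h1 : 1 ∈ H) :
    ∃ t, cs.IsReflection t ∧ H = {v | ¬ cs.IsLeftInversion v t} := by
  obtain ⟨a, t, ht, rfl⟩ := hH
  have hr : cs.IsReflection (a * t * a⁻¹) := ht.conj a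
  refine ⟨_, hr, ?_⟩
  rw [cs.setOf_length_lt_eq ht] at h1 ⊢
  rw [Set.mem_smul_set_iff_inv_smul_mem] at h1
  ext v
  rw [Set.mem_smul_set_iff_inv_smul_mem]
  have h2 := cs.isLeftInversion_mul_iff (w := a⁻¹) (u := v) ht
  simp only [smul_eq_mul, mul_one, Set.mem_ofPred_eq, inv_inv] at *
  tauto

theorem finite_halfSpaces_separating (x y : W) :
    {H ∈ halfSpaces cs | x ∈ H ∧ y ∉ H}.Finite := by
  refine ((cs.finite_setOf_isLeftInversion (x⁻¹ * y)).image
    fun t => x • {v | ¬ cs.IsLeftInversion v t}).subset ?_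
  rintro H ⟨hH, hx, hy⟩
  obtain ⟨t, ht, e⟩ := cs.exists_reflection_of_mem_halfSpaces (cs.smul_mem_halfSpaces hH x⁻¹)
    (by simpa [Set.mem_smul_set_iff_inv_smul_mem] using hx)
  refine ⟨t, ?_, by simp only [← e, smul_inv_smul]⟩
  rw [inv_smul_eq_iff] at e
  subst e
  simpa [Set.mem_smul_set_iff_inv_smul_mem] using hy

end CoxeterSystem

/-- The half-spaces containing `X` but not `Y`. -/
def halfSpacesSep (cs : CoxeterSystem M W) (X Y : Set W) : Set (Set W) :=
  {H ∈ halfSpaces cs | X ⊆ H ∧ ¬ Y ⊆ H}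

/-- The half-spaces whose boundary wall cuts `X`. -/
def halfSpacesCut (cs : CoxeterSystem M W) (X : Set W) : Set (Set W) :=
  {H ∈ halfSpaces cs | ¬ X ⊆ H ∧ ¬ X ⊆ Hᶜ}

/-- `Z` lies between `X` and `Y` with respect to half-spaces. -/
def HalfSpaceBetween (cs : CoxeterSystem M W) (X Y Z : Set W) : Prop :=
  ∀ H ∈ halfSpaces cs, (X ⊆ H → Y ⊆ H → Z ⊆ H) ∧ (Z ⊆ H → X ⊆ H ∨ Y ⊆ H)

namespace CoxeterSystem

variable (cs : CoxeterSystem M W)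

theorem finite_halfSpacesSep {X Y : Set W} (hX : X.Nonempty) (hY : Y.Finite) :
    (halfSpacesSep cs X Y).Finite := by
  obtain ⟨x, hx⟩ := hX
  refine (hY.biUnion fun y _ => cs.finite_halfSpaces_separating x y).subset ?_
  rintro H ⟨hH, hXH, hYH⟩
  obtain ⟨y, hy, hyH⟩ := Set.not_subset.1 hYH
  simp only [Set.mem_iUnion]
  exact ⟨y, hy, hH, hXH hx, hyH⟩

theorem finite_halfSpacesCut {X : Set W} (hf : X.Finite) :
    (halfSpacesCut cs X).Finite := by
  refine (hf.biUnion fun y _ => hf.biUnion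
    fun x _ => cs.finite_halfSpaces_separating x y).subset ?_
  rintro H ⟨hH, h1, h2⟩
  obtain ⟨y, hy, hyH⟩ := Set.not_subset.1 h1
  obtain ⟨x, hx, hxH⟩ := Set.not_subset.1 h2
  simp only [Set.mem_iUnion]
  exact ⟨y, hy, x, hx, hH, not_not.1 hxH, hyH⟩

theorem ncard_halfSpacesSep_smul (g : W) (X Y : Set W) :
    (halfSpacesSep cs (g • X) (g • Y)).ncard = (halfSpacesSep cs X Y).ncard := by
  have : halfSpacesSep cs (g • X) (g • Y) = (g • ·) '' halfSpacesSep cs X Y := by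
    ext H
    constructor
    · rintro ⟨hH, h1, h2⟩
      refine ⟨g⁻¹ • H, ⟨cs.smul_mem_halfSpaces hH _, ?_, ?_⟩, smul_inv_smul _ _⟩
      · rwa [Set.subset_smul_set_iff, inv_inv]
      · rwa [Set.subset_smul_set_iff, inv_inv]
    · rintro ⟨H, ⟨hH, h1, h2⟩, rfl⟩
      exact ⟨cs.smul_mem_halfSpaces hH _, Set.smul_set_subset_smul_set_iff.2 h1,
        fun h => h2 (Set.smul_set_subset_smul_set_iff.1 h)⟩
  rw [this, Set.ncard_image_of_injective _ (MulAction.injective g)]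

theorem ncard_halfSpacesCut_smul (g : W) (X : Set W) :
    (halfSpacesCut cs (g • X)).ncard = (halfSpacesCut cs X).ncard := by
  have : halfSpacesCut cs (g • X) = (g • ·) '' halfSpacesCut cs X := by
    ext H
    constructor
    · rintro ⟨hH, h1, h2⟩
      refine ⟨g⁻¹ • H, ⟨cs.smul_mem_halfSpaces hH _, ?_, ?_⟩, smul_inv_smul _ _⟩
      · rwa [Set.subset_smul_set_iff, inv_inv]
      · rwa [← Set.smul_set_compl, Set.subset_smul_set_iff, inv_inv]
    · rintro ⟨H, ⟨hH, h1, h2⟩, rfl⟩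
      refine ⟨cs.smul_mem_halfSpaces hH _, fun h => h1 (Set.smul_set_subset_smul_set_iff.1 h),
        fun h => h2 ?_⟩
      rw [← Set.smul_set_compl] at h
      exact Set.smul_set_subset_smul_set_iff.1 h
  rw [this, Set.ncard_image_of_injective _ (MulAction.injective g)]

theorem two_mul_ncard_halfSpacesSep_add {X Y : Set W} (hX : X.Nonempty) (hY : Y.Nonempty)
    (hXf : X.Finite) (hYf : Y.Finite) :
    2 * (halfSpacesSep cs Y X).ncard + (halfSpacesCut cs Y).ncard =
      2 * (halfSpacesSep cs X Y).ncard + (halfSpacesCut cs X).ncard := by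
  have key : ∀ {X Y : Set W}, X.Nonempty → Y.Nonempty → X.Finite → Y.Finite →
      (halfSpacesSep cs X Y).ncard =
        {H ∈ halfSpaces cs | X ⊆ H ∧ Y ⊆ Hᶜ}.ncard +
        {H ∈ halfSpaces cs | X ⊆ H ∧ H ∈ halfSpacesCut cs Y}.ncard ∧
      (halfSpacesCut cs Y).ncard =
        (halfSpacesCut cs X ∩ halfSpacesCut cs Y).ncard +
        2 * {H ∈ halfSpaces cs | X ⊆ H ∧ H ∈ halfSpacesCut cs Y}.ncard := by
    intro X Y hX hY hXf hYf
    have hS := cs.finite_halfSpacesSep hX hYf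
    have hC := cs.finite_halfSpacesCut hYf
    have hne : ∀ {Z H : Set W}, Z.Nonempty → Z ⊆ H → ¬ Z ⊆ Hᶜ :=
      fun ⟨z, hz⟩ h1 h2 => h2 hz (h1 hz)
    constructor
    · rw [← Set.ncard_union_eq ?_ ?_ ?_]
      · congr 1
        ext H
        have := @hne Y H hY
        simp only [halfSpacesSep, halfSpacesCut, Set.mem_union, Set.mem_ofPred_eq]
        tauto
      · rw [Set.disjoint_left]
        rintro H ⟨_, _, h1⟩ ⟨_, _, h2⟩
        exact h2.2.2 h1
      · exact hS.subset fun H h => ⟨h.1, h.2.1, fun h' => hne hY h' h.2.2⟩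
      · exact hS.subset fun H h => ⟨h.1, h.2.1, h.2.2.2.1⟩
    · have hc : {H ∈ halfSpaces cs | X ⊆ Hᶜ ∧ H ∈ halfSpacesCut cs Y} =
          compl '' {H ∈ halfSpaces cs | X ⊆ H ∧ H ∈ halfSpacesCut cs Y} := by
        ext H
        constructor
        · rintro ⟨h1, h2, _, h3, h4⟩
          exact ⟨Hᶜ, ⟨cs.compl_mem_halfSpaces h1, h2, cs.compl_mem_halfSpaces h1, h4,
            by rwa [compl_compl]⟩, compl_compl H⟩
        · rintro ⟨H, ⟨h1, h2, _, h3, h4⟩, rfl⟩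
          exact ⟨cs.compl_mem_halfSpaces h1, by rwa [compl_compl], cs.compl_mem_halfSpaces h1, h4,
            by rwa [compl_compl]⟩
      have hn : {H ∈ halfSpaces cs | X ⊆ Hᶜ ∧ H ∈ halfSpacesCut cs Y}.ncard =
          {H ∈ halfSpaces cs | X ⊆ H ∧ H ∈ halfSpacesCut cs Y}.ncard := by
        rw [hc, Set.ncard_image_of_injective _ compl_injective]
      rw [two_mul]
      nth_rw 2 [← hn]
      rw [← Set.ncard_union_eq ?_ ?_ ?_, ← Set.ncard_union_eq ?_ ?_ ?_]
      · congr 1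
        ext H
        simp only [halfSpacesCut, Set.mem_union, Set.mem_inter_iff, Set.mem_ofPred_eq]
        tauto
      · rw [Set.disjoint_left]
        rintro H ⟨h1, _⟩ (h2 | h2)
        · exact h1.2.1 h2.2.1
        · exact h1.2.2 h2.2.1
      · exact hC.subset fun H h => h.2
      · exact hC.subset fun H h => h.elim (fun h => h.2.2) fun h => h.2.2
      · rw [Set.disjoint_left]
        rintro H h1 h2
        exact hne hX h1.2.1 h2.2.1
      · exact hC.subset fun H h => h.2.2
      · exact hC.subset fun H h => h.2.2
  have hcompl : {H ∈ halfSpaces cs | Y ⊆ H ∧ X ⊆ Hᶜ}.ncard =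
      {H ∈ halfSpaces cs | X ⊆ H ∧ Y ⊆ Hᶜ}.ncard := by
    rw [← Set.ncard_image_of_injective _ compl_injective]
    congr 1
    ext H
    constructor
    · rintro ⟨H, ⟨h1, h2, h3⟩, rfl⟩
      exact ⟨cs.compl_mem_halfSpaces h1, h3, by rwa [compl_compl]⟩
    · rintro ⟨h1, h2, h3⟩
      exact ⟨Hᶜ, ⟨cs.compl_mem_halfSpaces h1, h3, by rwa [compl_compl]⟩, compl_compl H⟩
  obtain ⟨a1, a2⟩ := key hX hY hXf hYf
  obtain ⟨b1, b2⟩ := key hY hX hYf hXf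
  rw [Set.inter_comm] at b2
  omega

variable {cs}

theorem halfSpaceBetween_smul {X Y Z : Set W} (h : HalfSpaceBetween cs X Y Z) (g : W) :
    HalfSpaceBetween cs (g • X) (g • Y) (g • Z) := by
  intro H hH
  have := h (g⁻¹ • H) (cs.smul_mem_halfSpaces hH _)
  simpa only [Set.subset_smul_set_iff, inv_inv] using this

theorem _root_.HalfSpaceBetween.symm {X Y Z : Set W} (h : HalfSpaceBetween cs X Y Z) :
    HalfSpaceBetween cs Y X Z :=
  fun H hH => ⟨fun h1 h2 => (h H hH).1 h2 h1, fun h1 => ((h H hH).2 h1).symm⟩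

theorem _root_.HalfSpaceBetween.ncard_add {X Y Z : Set W} (h : HalfSpaceBetween cs X Y Z)
    (hX : X.Nonempty) (hZ : Z.Nonempty) (hYf : Y.Finite) (hZf : Z.Finite) :
    (halfSpacesSep cs X Y).ncard =
      (halfSpacesSep cs X Z).ncard + (halfSpacesSep cs Z Y).ncard := by
  rw [← Set.ncard_union_eq _ (cs.finite_halfSpacesSep hX hZf) (cs.finite_halfSpacesSep hZ hYf)]
  · congr 1
    ext H
    simp only [halfSpacesSep, Set.mem_union, Set.mem_ofPred_eq]
    constructor
    · rintro ⟨hH, h1, h2⟩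
      by_cases h3 : Z ⊆ H
      · exact Or.inr ⟨hH, h3, h2⟩
      · exact Or.inl ⟨hH, h1, h3⟩
    · rintro (⟨hH, h1, h2⟩ | ⟨hH, h1, h2⟩)
      · exact ⟨hH, h1, fun h3 => h2 ((h H hH).1 h1 h3)⟩
      · exact ⟨hH, ((h H hH).2 h1).resolve_right h2, h2⟩
  · rw [Set.disjoint_left]
    rintro H ⟨_, _, h1⟩ ⟨_, h2, _⟩
    exact h1 h2

variable (cs)

/-- Cosets of parabolic subgroups are intersections of half-spaces. -/
theorem subset_of_halfSpacesSep_eq_empty {I : Set B} {a : W} {Y : Set W}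
    (h : halfSpacesSep cs (a • (cs.parabolic I : Set W)) Y = ∅) :
    Y ⊆ a • (cs.parabolic I : Set W) := by
  intro b hb
  by_contra hc
  rw [Set.mem_smul_set_iff_inv_smul_mem, smul_eq_mul] at hc
  obtain ⟨v, ⟨x, hx, rfl⟩, hv⟩ : ∃ v ∈ {v | ∃ x ∈ cs.parabolic I, v = x * (a⁻¹ * b)},
      ∀ u ∈ {v | ∃ x ∈ cs.parabolic I, v = x * (a⁻¹ * b)}, cs.length v ≤ cs.length u := by
    have hne : {v | ∃ x ∈ cs.parabolic I, v = x * (a⁻¹ * b)}.Nonempty := ⟨_, 1, one_mem _, rfl⟩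
    exact ⟨Function.argminOn cs.length _ hne, Function.argminOn_mem _ _ _,
      fun u hu => Function.argminOn_le _ _ hu⟩
  have hne : x * (a⁻¹ * b) ≠ 1 := by
    intro e
    apply hc
    rw [← inv_eq_of_mul_eq_one_right e]
    exact inv_mem hx
  obtain ⟨i, hi⟩ := cs.exists_leftDescent_of_ne_one hne
  have hiI : cs.simple i ∉ cs.parabolic I := fun hiI =>
    absurd (hv _ ⟨cs.simple i * x, mul_mem hiI hx, by rw [mul_assoc]⟩) (not_le.2 hi)
  rw [← cs.isLeftInversion_simple_iff_isLeftDescent] at hi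
  apply Set.notMem_empty ((a * x⁻¹) • {v | ¬ cs.IsLeftInversion v (cs.simple i)})
  rw [← h]
  refine ⟨cs.smul_mem_halfSpaces (cs.setOf_not_isLeftInversion_mem (cs.isReflection_simple i)) _,
    ?_, fun hY => ?_⟩
  · rw [mul_smul, Set.smul_set_subset_smul_set_iff, Set.subset_smul_set_iff, inv_inv]
    rintro _ ⟨y, hy, rfl⟩ hyi
    exact hiI (cs.mem_parabolic_of_isLeftInversion (mul_mem hx hy) hyi)
  · have := hY hb
    rw [Set.mem_smul_set_iff_inv_smul_mem] at this
    apply this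
    convert hi using 1
    simp [mul_assoc]

end CoxeterSystem

namespace CoxeterSystem

variable {cs : CoxeterSystem M W}

/-- `v` has minimal length in the double coset `W_I v W_J`. -/
def IsMinimalDouble (cs : CoxeterSystem M W) (I J : Set B) (v : W) : Prop :=
  ∀ x ∈ cs.parabolic I, ∀ y ∈ cs.parabolic J, cs.length v ≤ cs.length (x * v * y)

theorem exists_isMinimalDouble (cs : CoxeterSystem M W) (I J : Set B) (w : W) :
    ∃ x ∈ cs.parabolic I, ∃ y ∈ cs.parabolic J, IsMinimalDouble cs I J (x * w * y) := by
  have hne : {v | ∃ x ∈ cs.parabolic I, ∃ y ∈ cs.parabolic J, v = x * w * y}.Nonempty :=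
    ⟨_, 1, one_mem _, 1, one_mem _, rfl⟩
  obtain ⟨_, ⟨x, hx, y, hy, rfl⟩, hv⟩ : ∃ v ∈ {v | ∃ x ∈ cs.parabolic I,
      ∃ y ∈ cs.parabolic J, v = x * w * y}, ∀ u ∈ {v | ∃ x ∈ cs.parabolic I,
      ∃ y ∈ cs.parabolic J, v = x * w * y}, cs.length v ≤ cs.length u :=
    ⟨Function.argminOn cs.length _ hne, Function.argminOn_mem _ _ _,
      fun u hu => Function.argminOn_le _ _ hu⟩
  refine ⟨x, hx, y, hy, fun x' hx' y' hy' =>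
    hv _ ⟨x' * x, mul_mem hx' hx, y * y', mul_mem hy hy', by group⟩⟩

theorem IsMinimalDouble.inv {I J : Set B} {v : W} (hv : IsMinimalDouble cs I J v) :
    IsMinimalDouble cs J I v⁻¹ := by
  intro x hx y hy
  have := hv y⁻¹ (inv_mem hy) x⁻¹ (inv_mem hx)
  rwa [← cs.length_inv v, ← cs.length_inv (y⁻¹ * v * x⁻¹), mul_inv_rev, mul_inv_rev, inv_inv,
    inv_inv, ← mul_assoc] at this

theorem IsMinimalDouble.not_isLeftInversion {I J : Set B} {v t : W}
    (hv : IsMinimalDouble cs I J v) (ht : t ∈ cs.parabolic I) : ¬ cs.IsLeftInversion v t := by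
  intro h
  have := hv t ht 1 (one_mem _)
  rw [mul_one] at this
  exact absurd h.2 (not_lt.2 this)

/-- The type of the projection of `v W_J` onto `W_I`. -/
def projType (cs : CoxeterSystem M W) (I J : Set B) (v : W) : Set B :=
  {i | cs.simple i ∈ cs.parabolic I ∧ v⁻¹ * cs.simple i * v ∈ cs.parabolic J}

theorem IsMinimalDouble.mem_parabolic_projType_iff {I J : Set B} {v : W}
    (hv : IsMinimalDouble cs I J v) {w : W} :
    w ∈ cs.parabolic (projType cs I J v) ↔
      w ∈ cs.parabolic I ∧ v⁻¹ * w * v ∈ cs.parabolic J := by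
  constructor
  · intro hw
    have : cs.parabolic (projType cs I J v) ≤
        cs.parabolic I ⊓ (cs.parabolic J).comap (MulAut.conj v⁻¹).toMonoidHom := by
      rw [Subgroup.closure_le]
      rintro _ ⟨i, hi, rfl⟩
      exact ⟨hi.1, by simpa [MulAut.conj_apply] using hi.2⟩
    simpa [MulAut.conj_apply] using this hw
  · rintro ⟨h1, h2⟩
    induction h : cs.length w using Nat.strong_induction_on generalizing w with
    | _ n ih =>
      by_cases hw : w = 1
      · rw [hw]; exact one_mem _
      obtain ⟨i, hi⟩ := cs.exists_leftDescent_of_ne_one hw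
      have hi' := (cs.isLeftInversion_simple_iff_isLeftDescent w i).2 hi
      have hiI := cs.mem_parabolic_of_isLeftInversion h1 hi'
      have hr := cs.isReflection_simple i
      have h3 : cs.IsLeftInversion (w * v) (cs.simple i) := by
        have := hv.not_isLeftInversion (mul_mem (mul_mem (inv_mem h1) hiI) h1)
        rw [cs.isLeftInversion_mul_iff hr]
        tauto
      rw [show w * v = v * (v⁻¹ * w * v) by group, cs.isLeftInversion_mul_iff hr] at h3
      have h4 := hv.not_isLeftInversion hiI
      have h5 := cs.mem_parabolic_of_isLeftInversion (t := v⁻¹ * cs.simple i * v) h2 (by tauto)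
      have h6 := ih (cs.length (cs.simple i * w)) (h ▸ hi) (mul_mem hiI h1)
        (by
          have := mul_mem h5 h2
          rwa [show v⁻¹ * cs.simple i * v * (v⁻¹ * w * v) = v⁻¹ * (cs.simple i * w) * v by group]
            at this) rfl
      have h7 := mul_mem (cs.simple_mem_parabolic (I := projType cs I J v) ⟨hiI, h5⟩) h6
      rwa [cs.simple_mul_simple_cancel_left] at h7

theorem IsMinimalDouble.halfSpaceBetween_projType {I J : Set B} {v : W}
    (hv : IsMinimalDouble cs I J v) :
    HalfSpaceBetween cs (cs.parabolic I : Set W) (v • (cs.parabolic J : Set W))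
      (cs.parabolic (projType cs I J v) : Set W) := by
  intro H hH
  refine ⟨fun h _ w hw => h (hv.mem_parabolic_projType_iff.1 hw).1, fun h => ?_⟩
  obtain ⟨t, ht, rfl⟩ := cs.exists_reflection_of_mem_halfSpaces hH (h (one_mem (cs.parabolic _)))
  by_contra! hc
  obtain ⟨x, hx, hxt⟩ := Set.not_subset.1 hc.1
  obtain ⟨_, ⟨z, hz, rfl⟩, hzt⟩ := Set.not_subset.1 hc.2
  have hxt : cs.IsLeftInversion x t := not_not.1 hxt
  have hzt : cs.IsLeftInversion (v * z) t := not_not.1 hzt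
  have h1 := cs.mem_parabolic_of_isLeftInversion hx hxt
  rw [cs.isLeftInversion_mul_iff ht] at hzt
  have h2 := hv.not_isLeftInversion h1
  have h3 := cs.mem_parabolic_of_isLeftInversion (t := v⁻¹ * t * v) hz (by tauto)
  exact h (hv.mem_parabolic_projType_iff.2 ⟨h1, h3⟩) (cs.isLeftInversion_self ht)

theorem IsMinimalDouble.exists_insert {I J : Set B} {v : W} (hv : IsMinimalDouble cs I J v)
    (hI : SphType cs I) (h1 : v ≠ 1)
    (hIJ : ∀ w, w ∈ cs.parabolic I ↔ v⁻¹ * w * v ∈ cs.parabolic J) :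
    ∃ i, cs.simple i ∉ cs.parabolic I ∧ SphType cs (insert i I) ∧
      HalfSpaceBetween cs (cs.parabolic I : Set W) (v • (cs.parabolic J : Set W))
        (cs.parabolic (insert i I) : Set W) := by
  obtain ⟨i, hi⟩ := cs.exists_leftDescent_of_ne_one h1
  rw [← cs.isLeftInversion_simple_iff_isLeftDescent] at hi
  have hiI : cs.simple i ∉ cs.parabolic I := fun h => hv.not_isLeftInversion h hi
  obtain ⟨w, hw, hmax⟩ := cs.exists_longest hI
  have hz : v⁻¹ * w * v ∈ cs.parabolic J := (hIJ w).1 hw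
  have hdesc : ∀ j ∈ insert i I, cs.IsLeftDescent (w * v) j := by
    intro j hj
    have hr := cs.isReflection_simple j
    rw [← cs.isLeftInversion_simple_iff_isLeftDescent]
    rcases hj with rfl | hj
    · rw [show w * v = v * (v⁻¹ * w * v) by group, cs.isLeftInversion_mul_iff hr]
      have : ¬ cs.IsLeftInversion (v⁻¹ * w * v) (v⁻¹ * cs.simple j * v) := fun h =>
        hiI ((hIJ _).2 (cs.mem_parabolic_of_isLeftInversion hz h))
      tauto
    · have hjI := cs.simple_mem_parabolic hj
      rw [cs.isLeftInversion_mul_iff hr]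
      have h2 := hmax _ hjI hr
      have h3 := hv.not_isLeftInversion (mul_mem (mul_mem (inv_mem hw) hjI) hw)
      tauto
  have hmono : cs.parabolic I ≤ cs.parabolic (insert i I) :=
    Subgroup.closure_mono (Set.image_mono (Set.subset_insert i I))
  refine ⟨i, hiI, cs.sphType_of_forall_isLeftDescent hdesc, fun H hH => ⟨fun hX hY u hu => ?_,
    fun h => Or.inl fun x hx => h (hmono hx)⟩⟩
  obtain ⟨t, ht, rfl⟩ := cs.exists_reflection_of_mem_halfSpaces hH (hX (one_mem (cs.parabolic _)))
  intro hut
  refine hY ⟨_, hz, ?_⟩ (cs.isLeftInversion_of_length_eq_add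
    (cs.length_eq_add_of_forall_isLeftDescent hdesc hu) hut)
  simp [mul_assoc]

theorem smul_parabolic_eq_of_mem {I : Set B} {x : W} (hx : x ∈ cs.parabolic I) :
    x • (cs.parabolic I : Set W) = cs.parabolic I := by
  ext w
  rw [Set.mem_smul_set_iff_inv_smul_mem, smul_eq_mul]
  exact Subgroup.mul_mem_cancel_left _ (inv_mem hx)

theorem sphType_of_parabolic_le {I J : Set B} (h : cs.parabolic J ≤ cs.parabolic I)
    (hI : SphType cs I) : SphType cs J :=
  Set.Finite.subset hI h

/-- Two spherical cosets none of which contains the other admit a spherical coset between them. -/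
theorem exists_halfSpaceBetween {I J : Set B} (hI : SphType cs I) (hJ : SphType cs J) {a b : W}
    (hab : ¬ a • (cs.parabolic I : Set W) ⊆ b • (cs.parabolic J : Set W))
    (hba : ¬ b • (cs.parabolic J : Set W) ⊆ a • (cs.parabolic I : Set W)) :
    ∃ (K : Set B) (c : W), SphType cs K ∧
      HalfSpaceBetween cs (a • (cs.parabolic I : Set W)) (b • (cs.parabolic J : Set W))
        (c • (cs.parabolic K : Set W)) ∧
      c • (cs.parabolic K : Set W) ≠ a • (cs.parabolic I : Set W) ∧
      c • (cs.parabolic K : Set W) ≠ b • (cs.parabolic J : Set W) := by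
  obtain ⟨x, hx, y, hy, hv⟩ := exists_isMinimalDouble cs I J (a⁻¹ * b)
  obtain ⟨v, hve⟩ : ∃ v, v = x * (a⁻¹ * b) * y := ⟨_, rfl⟩
  rw [← hve] at hv
  have ea : a • (cs.parabolic I : Set W) = (a * x⁻¹) • (cs.parabolic I : Set W) := by
    rw [mul_smul, smul_parabolic_eq_of_mem (inv_mem hx)]
  have eb : b • (cs.parabolic J : Set W) = (a * x⁻¹) • v • (cs.parabolic J : Set W) := by
    have e : a * x⁻¹ * v = b * y := by rw [hve]; group
    rw [← mul_smul, e, mul_smul, smul_parabolic_eq_of_mem hy]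
  rw [ea, eb] at hab hba ⊢
  generalize a * x⁻¹ = g at *
  rw [Set.smul_set_subset_smul_set_iff] at hab hba
  suffices h : ∃ (K : Set B) (c : W), SphType cs K ∧
      HalfSpaceBetween cs (cs.parabolic I : Set W) (v • (cs.parabolic J : Set W))
        (c • (cs.parabolic K : Set W)) ∧
      c • (cs.parabolic K : Set W) ≠ (cs.parabolic I : Set W) ∧
      c • (cs.parabolic K : Set W) ≠ v • (cs.parabolic J : Set W) by
    obtain ⟨K, c, h1, h2, h3, h4⟩ := h
    refine ⟨K, g * c, h1, ?_, ?_, ?_⟩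
    · rw [mul_smul]
      exact halfSpaceBetween_smul h2 g
    · rw [mul_smul]
      exact fun h => h3 (smul_left_cancel g h)
    · rw [mul_smul]
      exact fun h => h4 (smul_left_cancel g h)
  by_cases hA : ∃ w ∈ cs.parabolic I, v⁻¹ * w * v ∉ cs.parabolic J
  · obtain ⟨w, hw, hwJ⟩ := hA
    have hle : cs.parabolic (projType cs I J v) ≤ cs.parabolic I :=
      fun u hu => (hv.mem_parabolic_projType_iff.1 hu).1
    refine ⟨projType cs I J v, 1, sphType_of_parabolic_le hle hI, ?_, ?_, ?_⟩
    · rw [one_smul]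
      exact hv.halfSpaceBetween_projType
    · rw [one_smul]
      intro e
      have : w ∈ (cs.parabolic (projType cs I J v) : Set W) := e ▸ hw
      exact hwJ (hv.mem_parabolic_projType_iff.1 this).2
    · rw [one_smul]
      intro e
      exact hba (e ▸ hle)
  by_cases hB : ∃ w ∈ cs.parabolic J, v * w * v⁻¹ ∉ cs.parabolic I
  · obtain ⟨w, hw, hwI⟩ := hB
    have hle : cs.parabolic (projType cs J I v⁻¹) ≤ cs.parabolic J :=
      fun u hu => (hv.inv.mem_parabolic_projType_iff.1 hu).1
    refine ⟨projType cs J I v⁻¹, v, sphType_of_parabolic_le hle hJ, ?_, ?_, ?_⟩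
    · have := (halfSpaceBetween_smul hv.inv.halfSpaceBetween_projType v).symm
      rwa [smul_inv_smul] at this
    · intro e
      apply hab
      rw [← e]
      exact Set.smul_set_mono hle
    · intro e
      have : w ∈ (cs.parabolic (projType cs J I v⁻¹) : Set W) := smul_left_cancel v e ▸ hw
      exact hwI (by simpa using (hv.inv.mem_parabolic_projType_iff.1 this).2)
  push Not at hA hB
  have hIJ : ∀ w, w ∈ cs.parabolic I ↔ v⁻¹ * w * v ∈ cs.parabolic J := by
    refine fun w => ⟨hA w, fun h => ?_⟩
    have := hB _ h
    rwa [show v * (v⁻¹ * w * v) * v⁻¹ = w by group] at this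
  have h1 : v ≠ 1 := by
    rintro rfl
    apply hab
    intro w hw
    rw [one_smul]
    simpa using hA w hw
  obtain ⟨i, hi, hsph, hbt⟩ := hv.exists_insert hI h1 hIJ
  have hmono : cs.parabolic I ≤ cs.parabolic (insert i I) :=
    Subgroup.closure_mono (Set.image_mono (Set.subset_insert i I))
  refine ⟨insert i I, 1, hsph, by rwa [one_smul], ?_, ?_⟩
  · rw [one_smul]
    intro e
    have : cs.simple i ∈ (cs.parabolic I : Set W) :=
      e ▸ cs.simple_mem_parabolic (Set.mem_insert i I)
    exact hi this
  · rw [one_smul]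
    intro e
    exact hab (e ▸ hmono)

end CoxeterSystem

namespace Bldg

variable {cs : CoxeterSystem M W} (X : Bldg cs)

theorem delta_self (C : X.Chamber) : X.delta C C = 1 := (X.delta_eq_one_iff C C).2 rfl

variable {X}

theorem delta_eq_simple_symm {C D : X.Chamber} {i : B} (h : X.delta C D = cs.simple i) :
    X.delta D C = cs.simple i := by
  obtain ⟨E, h1, h2⟩ := X.exists_delta C D i
  rw [h, cs.simple_mul_simple_self] at h2
  rwa [(X.delta_eq_one_iff C E).1 h2]

theorem delta_eq_mul {D E C : X.Chamber}
    (h : cs.length (X.delta D E * X.delta E C) =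
      cs.length (X.delta D E) + cs.length (X.delta E C)) :
    X.delta D C = X.delta D E * X.delta E C := by
  induction hn : cs.length (X.delta E C) using Nat.strong_induction_on generalizing C with
  | _ n ih =>
    by_cases h1 : X.delta E C = 1
    · rw [h1, mul_one, (X.delta_eq_one_iff E C).1 h1]
    obtain ⟨i, hi⟩ := cs.exists_rightDescent_of_ne_one h1
    obtain ⟨C', hC, hE⟩ := X.exists_delta E C i
    have hi' := cs.isRightDescent_iff.1 hi
    have e : X.delta D E * X.delta E C' * cs.simple i = X.delta D E * X.delta E C := by
      rw [hE, ← mul_assoc, cs.simple_mul_simple_cancel_right]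
    have h2 := cs.length_mul_le (X.delta D E * X.delta E C') (cs.simple i)
    have h3 := cs.length_mul_le (X.delta D E) (X.delta E C')
    rw [e, cs.length_simple] at h2
    rw [← hE] at hi'
    have h4 := ih _ (by omega) (C := C') (by omega) rfl
    rw [X.delta_eq_of_length D C' C i (delta_eq_simple_symm hC) (by rw [h4, e]; omega), h4, e]

variable (X)

theorem delta_symm (C D : X.Chamber) : X.delta D C = (X.delta C D)⁻¹ := by
  induction hn : cs.length (X.delta C D) using Nat.strong_induction_on generalizing D with
  | _ n ih =>
    by_cases h1 : X.delta C D = 1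
    · rw [h1, inv_one, X.delta_eq_one_iff, (X.delta_eq_one_iff C D).1 h1]
    obtain ⟨i, hi⟩ := cs.exists_rightDescent_of_ne_one h1
    obtain ⟨D', hD, hC⟩ := X.exists_delta C D i
    have hi' := cs.isRightDescent_iff.1 hi
    rw [← hC] at hi'
    have h2 := ih _ (by omega) D' rfl
    have e : X.delta D D' * X.delta D' C = (X.delta C D)⁻¹ := by
      rw [hD, h2, hC, mul_inv_rev, cs.inv_simple, cs.simple_mul_simple_cancel_left]
    rw [← e]
    refine delta_eq_mul ?_
    rw [e, hD, h2, cs.length_inv, cs.length_inv, cs.length_simple]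
    omega

theorem length_delta_le (C D E : X.Chamber) :
    cs.length ((X.delta C D)⁻¹ * X.delta C E) ≤ cs.length (X.delta D E) := by
  induction hn : cs.length (X.delta D E) using Nat.strong_induction_on generalizing E with
  | _ n ih =>
    by_cases h1 : X.delta D E = 1
    · rw [(X.delta_eq_one_iff D E).1 h1]
      simp
    obtain ⟨i, hi⟩ := cs.exists_rightDescent_of_ne_one h1
    obtain ⟨E', hE, hD⟩ := X.exists_delta D E i
    have hi' := cs.isRightDescent_iff.1 hi
    rw [← hD] at hi'
    have h2 := ih _ (by omega) E' rfl
    rcases X.delta_mem_pair C E' E i (delta_eq_simple_symm hE) with h3 | h3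
    · have := cs.length_mul_le ((X.delta C D)⁻¹ * X.delta C E') (cs.simple i)
      rw [cs.length_simple, mul_assoc, ← h3] at this
      omega
    · rw [h3]
      omega

variable {X}

theorem delta_inv_mul_mem_parabolic {I : Set B} {D E : X.Chamber}
    (h : X.delta D E ∈ cs.parabolic I) (C : X.Chamber) :
    (X.delta C D)⁻¹ * X.delta C E ∈ cs.parabolic I := by
  obtain ⟨u, hu⟩ : ∃ u, u = X.delta D E := ⟨_, rfl⟩
  rw [← hu] at h
  induction h using Subgroup.closure_induction_right generalizing E with
  | one =>
    rw [(X.delta_eq_one_iff D E).1 hu.symm, inv_mul_cancel]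
    exact one_mem _
  | mul_right x hx y hy ih =>
    obtain ⟨i, hi, rfl⟩ := hy
    obtain ⟨E', hE, hD⟩ := X.exists_delta D E i
    have h1 := ih (E := E') (by rw [hD, ← hu, cs.simple_mul_simple_cancel_right])
    rcases X.delta_mem_pair C E' E i (delta_eq_simple_symm hE) with h3 | h3
    · rw [h3, ← mul_assoc]
      exact mul_mem h1 (cs.simple_mem_parabolic hi)
    · rwa [h3]
  | mul_inv_cancel x hx y hy ih =>
    obtain ⟨i, hi, rfl⟩ := hy
    obtain ⟨E', hE, hD⟩ := X.exists_delta D E i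
    have h1 := ih (E := E') (by
      rw [hD, ← hu, cs.inv_simple, cs.simple_mul_simple_cancel_right])
    rcases X.delta_mem_pair C E' E i (delta_eq_simple_symm hE) with h3 | h3
    · rw [h3, ← mul_assoc]
      exact mul_mem h1 (cs.simple_mem_parabolic hi)
    · rwa [h3]

/-- A partial isometry from the Coxeter group to the building extends to neighbours. -/
theorem exists_delta_eq_of_isometry {G : Set (W × X.Chamber)}
    (hG : ∀ p ∈ G, ∀ q ∈ G, X.delta p.2 q.2 = p.1⁻¹ * q.1) {p : W × X.Chamber} (hp : p ∈ G)
    (i : B) : ∃ E, ∀ q ∈ G, X.delta E q.2 = (p.1 * cs.simple i)⁻¹ * q.1 := by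
  obtain ⟨E, hE, hE'⟩ : ∃ E, X.delta p.2 E = cs.simple i ∧
      ((∃ q ∈ G, cs.IsLeftDescent (p.1⁻¹ * q.1) i) → ∃ q ∈ G,
        cs.IsLeftDescent (p.1⁻¹ * q.1) i ∧ X.delta E q.2 = cs.simple i * (p.1⁻¹ * q.1)) := by
    by_cases h : ∃ q ∈ G, cs.IsLeftDescent (p.1⁻¹ * q.1) i
    · obtain ⟨q, hq, hqi⟩ := h
      obtain ⟨E, h1, h2⟩ := X.exists_delta q.2 p.2 i
      refine ⟨E, h1, fun _ => ⟨q, hq, hqi, ?_⟩⟩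
      rw [X.delta_symm q.2 E, h2, hG q hq p hp]
      simp [mul_assoc]
    · obtain ⟨E, h1, h2⟩ := X.exists_delta p.2 p.2 i
      exact ⟨E, h1, fun h' => absurd h' h⟩
  refine ⟨E, fun q hq => ?_⟩
  rw [mul_inv_rev, cs.inv_simple, mul_assoc, ← hG p hp q hq]
  by_cases hqi : cs.IsLeftDescent (p.1⁻¹ * q.1) i
  · obtain ⟨r, hr, hri, hrE⟩ := hE' ⟨q, hq, hqi⟩
    have h1 := X.delta_mem_pair q.2 p.2 E i hE
    rw [X.delta_symm E q.2, X.delta_symm p.2 q.2] at h1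
    rcases h1 with h1 | h1
    · rw [← inv_inj, h1, mul_inv_rev, cs.inv_simple]
    exfalso
    rw [inv_inj] at h1
    have h2 := X.length_delta_le E r.2 q.2
    rw [hrE, h1, hG p hp q hq, hG r hr q hq] at h2
    rw [← cs.isLeftInversion_simple_iff_isLeftDescent] at hqi hri
    have hrefl := cs.isReflection_simple i
    rw [show p.1⁻¹ * q.1 = p.1⁻¹ * r.1 * (r.1⁻¹ * q.1) by group,
      cs.isLeftInversion_mul_iff hrefl] at hqi
    apply hqi
    refine iff_of_true hri ?_
    have ht : cs.IsReflection ((p.1⁻¹ * r.1)⁻¹ * cs.simple i * (p.1⁻¹ * r.1)) := by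
      simpa using hrefl.conj (p.1⁻¹ * r.1)⁻¹
    refine ⟨ht, lt_of_le_of_ne ((congrArg cs.length ?_).trans_le h2) (ht.length_mul_right_ne _)⟩
    rw [mul_inv_rev (cs.simple i), cs.inv_simple]
    group
  · rw [cs.not_isLeftDescent_iff, ← hG p hp q hq] at hqi
    have h1 := delta_eq_simple_symm hE
    rw [← h1]
    refine delta_eq_mul ?_
    rw [h1, hqi, cs.length_simple, add_comm]

variable (X)

/-- Any two chambers lie in a common apartment. -/
theorem exists_isApartMap (C D : X.Chamber) :
    ∃ α : W → X.Chamber, X.IsApartMap α ∧ C ∈ Set.range α ∧ D ∈ Set.range α := by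
  obtain ⟨G, hsub, hmax⟩ := zorn_subset_nonempty
    {G : Set (W × X.Chamber) | ∀ p ∈ G, ∀ q ∈ G, X.delta p.2 q.2 = p.1⁻¹ * q.1}
    (fun c hc hchain hne => ⟨⋃₀ c, by
      rintro p ⟨s, hs, hp⟩ q ⟨t, ht, hq⟩
      rcases hchain.total hs ht with h | h
      · exact hc ht p (h hp) q hq
      · exact hc hs p hp q (h hq), fun s hs => Set.subset_sUnion_of_mem hs⟩)
    {(1, C), (X.delta C D, D)} (by
      rintro p (rfl | rfl) q (rfl | rfl)
      · simp [X.delta_self]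
      · simp
      · simp [X.delta_symm C D]
      · simp [X.delta_self])
  have hG := hmax.prop
  have hext : ∀ w : W, ∃ E, (w, E) ∈ G := by
    intro w
    induction w using cs.simple_induction_right with
    | one => exact ⟨C, hsub (Or.inl rfl)⟩
    | mul_simple_right w i ih =>
      obtain ⟨E, hE⟩ := ih
      obtain ⟨F, hF⟩ := exists_delta_eq_of_isometry hG hE i
      refine ⟨F, hmax.le_of_ge (y := insert (w * cs.simple i, F) G) ?_ (Set.subset_insert _ _)
        (Set.mem_insert _ _)⟩
      rintro p (rfl | hp) q (rfl | hq)
      · simp [X.delta_self]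
      · exact hF q hq
      · rw [X.delta_symm, hF p hp]
        simp
      · exact hG p hp q hq
  choose α hα using hext
  have hδ : ∀ v w, X.delta (α v) (α w) = v⁻¹ * w := fun v w => hG _ (hα v) _ (hα w)
  have hr : ∀ {w E}, (w, E) ∈ G → E ∈ Set.range α := by
    intro w E hE
    refine ⟨w, (X.delta_eq_one_iff _ _).1 ?_⟩
    simpa using hG _ (hα w) _ hE
  refine ⟨α, ⟨fun v w h => ?_, hδ⟩, hr (hsub (Or.inl rfl)), hr (hsub (Or.inr rfl))⟩
  have := hδ v w
  rw [h, X.delta_self] at this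
  exact (inv_mul_eq_one.1 this.symm)

end Bldg

namespace Bldg

variable {cs : CoxeterSystem M W} (X : Bldg cs)

theorem residue_eq_of_mem {I : Set B} {C D : X.Chamber} (h : D ∈ X.residue I C) :
    X.residue I D = X.residue I C := by
  have h' : X.delta C D ∈ cs.parabolic I := h
  ext E
  change X.delta D E ∈ cs.parabolic I ↔ X.delta C E ∈ cs.parabolic I
  constructor <;> intro hE
  · have := mul_mem h' (delta_inv_mul_mem_parabolic hE C)
    rwa [mul_inv_cancel_left] at this
  · have := mul_mem (inv_mem h') (delta_inv_mul_mem_parabolic hE D)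
    rwa [X.delta_symm C D, inv_inv, ← mul_assoc, inv_mul_cancel, one_mul] at this

variable {X}

/-- A type of a spherical residue. -/
def resType (R : X.Res) : Set B := R.2.choose

theorem sphType_resType (R : X.Res) : SphType cs (resType R) := R.2.choose_spec.choose_spec.1

theorem eq_residue_resType (R : X.Res) {C : X.Chamber} (hC : C ∈ R.1) :
    R.1 = X.residue (resType R) C := by
  have h := R.2.choose_spec.choose_spec.2
  rw [h] at hC
  exact h.trans (X.residue_eq_of_mem hC).symm

theorem res_nonempty (R : X.Res) : R.1.Nonempty := by
  obtain ⟨I, C, -, h⟩ := R.2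
  rw [h]
  refine ⟨C, ?_⟩
  change X.delta C C ∈ cs.parabolic I
  rw [X.delta_self]
  exact one_mem _

theorem IsApartMap.preimage_residue {α : W → X.Chamber} (hα : X.IsApartMap α) (I : Set B)
    (a : W) : α ⁻¹' X.residue I (α a) = a • (cs.parabolic I : Set W) := by
  ext w
  rw [Set.mem_smul_set_iff_inv_smul_mem, smul_eq_mul]
  change X.delta (α a) (α w) ∈ cs.parabolic I ↔ _
  rw [hα.2]
  rfl

theorem IsApartMap.preimage_res {α : W → X.Chamber} (hα : X.IsApartMap α) {R : X.Res} {a : W}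
    (ha : a ∈ α ⁻¹' R.1) : α ⁻¹' R.1 = a • (cs.parabolic (resType R) : Set W) := by
  rw [eq_residue_resType R ha, hα.preimage_residue]

theorem IsApartMap.finite_preimage {α : W → X.Chamber} (hα : X.IsApartMap α) (R : X.Res) :
    (α ⁻¹' R.1).Finite := by
  rcases (α ⁻¹' R.1).eq_empty_or_nonempty with h | ⟨a, ha⟩
  · rw [h]
    exact Set.finite_empty
  · rw [hα.preimage_res ha]
    exact Set.Finite.smul_set (sphType_resType R)

theorem IsApartMap.subset_of_preimage_subset {α : W → X.Chamber} (hα : X.IsApartMap α)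
    {R T : X.Res} (hR : (α ⁻¹' R.1).Nonempty) (h : α ⁻¹' R.1 ⊆ α ⁻¹' T.1) : R.1 ⊆ T.1 := by
  obtain ⟨b, hb⟩ := hR
  have hbT : α b ∈ T.1 := h hb
  rw [hα.preimage_res hb, hα.preimage_res (show b ∈ α ⁻¹' T.1 from hbT),
    Set.smul_set_subset_smul_set_iff] at h
  rw [eq_residue_resType R hb, eq_residue_resType T hbT]
  exact fun D hD => h hD

theorem exists_isApartMap_res (R T : X.Res) : ∃ α : W → X.Chamber,
    X.IsApartMap α ∧ (α ⁻¹' R.1).Nonempty ∧ (α ⁻¹' T.1).Nonempty := by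
  obtain ⟨C, hC⟩ := res_nonempty R
  obtain ⟨D, hD⟩ := res_nonempty T
  obtain ⟨α, hα, ⟨a, rfl⟩, ⟨b, rfl⟩⟩ := X.exists_isApartMap C D
  exact ⟨α, hα, ⟨a, hC⟩, ⟨b, hD⟩⟩

/-- The traces of two residues on an apartment do not depend on the apartment, up to translation. -/
theorem exists_preimage_eq_smul {α β : W → X.Chamber} (hα : X.IsApartMap α)
    (hβ : X.IsApartMap β) {R T : X.Res} (hR : (α ⁻¹' R.1).Nonempty) (hT : (α ⁻¹' T.1).Nonempty)
    (hR' : (β ⁻¹' R.1).Nonempty) (hT' : (β ⁻¹' T.1).Nonempty) :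
    ∃ g : W, β ⁻¹' R.1 = g • α ⁻¹' R.1 ∧ β ⁻¹' T.1 = g • α ⁻¹' T.1 := by
  obtain ⟨a, ha⟩ := hR
  obtain ⟨b, hb⟩ := hT
  obtain ⟨c, hc⟩ := hR'
  obtain ⟨d, hd⟩ := hT'
  have h1 : X.delta (α a) (β c) ∈ cs.parabolic (resType R) := by
    have : β c ∈ R.1 := hc
    rwa [eq_residue_resType R ha] at this
  have h2 : X.delta (α b) (β d) ∈ cs.parabolic (resType T) := by
    have : β d ∈ T.1 := hd
    rwa [eq_residue_resType T hb] at this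
  have h1 := delta_inv_mul_mem_parabolic h1 (β d)
  have h2 := delta_inv_mul_mem_parabolic h2 (α a)
  rw [hα.2] at h2
  rw [X.delta_symm (α a), inv_inv, hβ.2] at h1
  obtain ⟨m, hm⟩ : ∃ m, m = X.delta (α a) (β d) := ⟨_, rfl⟩
  rw [← hm] at h1 h2
  rw [hα.preimage_res ha, hα.preimage_res hb, hβ.preimage_res hc, hβ.preimage_res hd]
  refine ⟨c * (m * (d⁻¹ * c))⁻¹ * a⁻¹, ?_, ?_⟩
  · rw [smul_smul, inv_mul_cancel_right, mul_smul,
      CoxeterSystem.smul_parabolic_eq_of_mem (inv_mem h1)]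
  · have e : c * (m * (d⁻¹ * c))⁻¹ * a⁻¹ * b = d * ((a⁻¹ * b)⁻¹ * m)⁻¹ := by group
    rw [smul_smul, e, mul_smul, CoxeterSystem.smul_parabolic_eq_of_mem (inv_mem h2)]

theorem IsApartMap.isRootOf_iff {α : W → X.Chamber} (hα : X.IsApartMap α) {φ : Set X.Chamber} :
    X.IsRootOf (Set.range α) φ ↔ ∃ H ∈ halfSpaces cs, α '' H = φ := by
  constructor
  · rintro ⟨β, hβ, hr, t, ht, rfl⟩
    obtain ⟨g, hg⟩ : β 1 ∈ Set.range α := hr ▸ Set.mem_range_self 1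
    have hβα : ∀ w, β w = α (g * w) := by
      intro w
      obtain ⟨u, hu⟩ : β w ∈ Set.range α := hr ▸ Set.mem_range_self w
      have := hβ.2 1 w
      rw [← hg, ← hu, hα.2, inv_one, one_mul] at this
      rw [← hu, inv_mul_eq_iff_eq_mul.1 this]
    refine ⟨_, ⟨g, t, ht, rfl⟩, ?_⟩
    rw [← Set.image_smul, Set.image_image]
    exact Set.image_congr fun w _ => (hβα w).symm
  · rintro ⟨_, ⟨g, t, ht, rfl⟩, rfl⟩
    refine ⟨fun w => α (g * w), ⟨hα.1.comp (mul_right_injective g), fun v w => ?_⟩, ?_, t, ht, ?_⟩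
    · rw [hα.2]
      group
    · exact ((mul_left_surjective g).range_comp α).symm
    · rw [← Set.image_smul, Set.image_image]
      rfl

theorem IsApartMap.containedInRoot_iff {α : W → X.Chamber} (hα : X.IsApartMap α) {R : X.Res}
    {H : Set W} : X.ContainedInRoot R (Set.range α) (α '' H) ↔ α ⁻¹' R.1 ⊆ H := by
  rw [ContainedInRoot, ← Set.image_preimage_eq_inter_range, Set.image_subset_image_iff hα.1]

theorem IsApartMap.ncard_phiSep {α : W → X.Chamber} (hα : X.IsApartMap α) (R T : X.Res) :
    (X.PhiSep (Set.range α) R T).ncard =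
      (halfSpacesSep cs (α ⁻¹' R.1) (α ⁻¹' T.1)).ncard := by
  rw [← Set.ncard_image_of_injective _ hα.1.image_injective]
  congr 1
  ext φ
  constructor
  · rintro ⟨h1, h2, h3⟩
    obtain ⟨H, hH, rfl⟩ := hα.isRootOf_iff.1 h1
    rw [hα.containedInRoot_iff] at h2 h3
    exact ⟨H, ⟨hH, h2, h3⟩, rfl⟩
  · rintro ⟨H, ⟨hH, h2, h3⟩, rfl⟩
    exact ⟨hα.isRootOf_iff.2 ⟨H, hH, rfl⟩, hα.containedInRoot_iff.2 h2,
      mt hα.containedInRoot_iff.1 h3⟩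

/-- The number of half-spaces containing `R` but not `T`, in an apartment meeting both. -/
def sepNum (R T : X.Res) : ℕ :=
  (halfSpacesSep cs ((exists_isApartMap_res R T).choose ⁻¹' R.1)
    ((exists_isApartMap_res R T).choose ⁻¹' T.1)).ncard

theorem IsApartMap.sepNum_eq {α : W → X.Chamber} (hα : X.IsApartMap α) {R T : X.Res}
    (hR : (α ⁻¹' R.1).Nonempty) (hT : (α ⁻¹' T.1).Nonempty) :
    sepNum R T = (halfSpacesSep cs (α ⁻¹' R.1) (α ⁻¹' T.1)).ncard := by
  obtain ⟨hβ, hR', hT'⟩ := (exists_isApartMap_res R T).choose_spec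
  obtain ⟨g, h1, h2⟩ := exists_preimage_eq_smul hα hβ hR hT hR' hT'
  rw [sepNum, h1, h2, cs.ncard_halfSpacesSep_smul]

theorem rootDist_eq_sepNum_add (R T : X.Res) :
    X.rootDist R T = ((sepNum R T + sepNum T R : ℕ) : ℝ) / 2 := by
  have h : ∃ A, X.IsApartment A ∧ X.LiesIn R A ∧ X.LiesIn T A := by
    obtain ⟨α, hα, ⟨a, ha⟩, ⟨b, hb⟩⟩ := exists_isApartMap_res R T
    exact ⟨_, ⟨α, hα, rfl⟩, ⟨α a, ha, a, rfl⟩, ⟨α b, hb, b, rfl⟩⟩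
  obtain ⟨⟨α, hα, hA⟩, ⟨_, h1, h2⟩, ⟨_, h3, h4⟩⟩ := Classical.epsilon_spec h
  change X.chooseApt R T = _ at hA
  change _ ∈ X.chooseApt R T at h2 h4
  rw [hA] at h2 h4
  obtain ⟨a, rfl⟩ := h2
  obtain ⟨b, rfl⟩ := h4
  rw [rootDist, hA, hα.ncard_phiSep, hα.ncard_phiSep, hα.sepNum_eq ⟨a, h1⟩ ⟨b, h3⟩,
    hα.sepNum_eq ⟨b, h3⟩ ⟨a, h1⟩]

theorem rootDist_comm (R T : X.Res) : X.rootDist R T = X.rootDist T R := by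
  rw [rootDist_eq_sepNum_add, rootDist_eq_sepNum_add, add_comm]

theorem interval_comm (R T : X.Res) : X.interval R T = X.interval T R := by
  ext σ
  simp only [interval, Set.mem_ofPred_eq]
  rw [rootDist_comm R T, rootDist_comm R σ, rootDist_comm σ T, add_comm]

/-- The number of half-spaces of an apartment whose wall cuts `R`. -/
def cutNum (R : X.Res) : ℕ := (halfSpacesCut cs (cs.parabolic (resType R) : Set W)).ncard

theorem two_mul_sepNum_add_cutNum (R T : X.Res) :
    2 * sepNum T R + cutNum T = 2 * sepNum R T + cutNum R := by
  obtain ⟨α, hα, ⟨a, ha⟩, ⟨b, hb⟩⟩ := exists_isApartMap_res R T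
  have h := cs.two_mul_ncard_halfSpacesSep_add ⟨a, ha⟩ ⟨b, hb⟩ (hα.finite_preimage R)
    (hα.finite_preimage T)
  rw [← hα.sepNum_eq ⟨a, ha⟩ ⟨b, hb⟩, ← hα.sepNum_eq ⟨b, hb⟩ ⟨a, ha⟩, hα.preimage_res ha,
    hα.preimage_res hb, cs.ncard_halfSpacesCut_smul, cs.ncard_halfSpacesCut_smul] at h
  exact h

theorem rootDist_eq (R T : X.Res) :
    X.rootDist R T = sepNum R T + ((cutNum R : ℝ) - cutNum T) / 4 := by
  have h : (2 * sepNum T R + cutNum T : ℝ) = 2 * sepNum R T + cutNum R := by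
    exact_mod_cast two_mul_sepNum_add_cutNum R T
  rw [rootDist_eq_sepNum_add]
  push_cast
  linarith

theorem mem_interval_iff {R T σ : X.Res} :
    σ ∈ X.interval R T ↔ sepNum R T = sepNum R σ + sepNum σ T := by
  simp only [interval, Set.mem_ofPred_eq, rootDist_eq]
  rw [← @Nat.cast_inj ℝ]
  push_cast
  constructor <;> intro h <;> linarith

theorem sepNum_eq_zero_iff {R T : X.Res} : sepNum R T = 0 ↔ X.leRes R T := by
  obtain ⟨α, hα, ⟨a, ha⟩, hT⟩ := exists_isApartMap_res R T
  rw [hα.sepNum_eq ⟨a, ha⟩ hT,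
    Set.ncard_eq_zero (cs.finite_halfSpacesSep ⟨a, ha⟩ (hα.finite_preimage T))]
  constructor
  · intro h
    apply hα.subset_of_preimage_subset hT
    rw [hα.preimage_res ha] at h ⊢
    exact cs.subset_of_halfSpacesSep_eq_empty h
  · intro h
    rw [Set.eq_empty_iff_forall_notMem]
    rintro H ⟨-, h1, h2⟩
    exact h2 ((Set.preimage_mono h).trans h1)

theorem exists_mem_interval_ne {R T : X.Res} (h1 : ¬ X.leRes R T) (h2 : ¬ X.leRes T R) :
    ∃ σ ∈ X.interval R T, σ ≠ R ∧ σ ≠ T := by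
  obtain ⟨α, hα, ⟨a, ha⟩, ⟨b, hb⟩⟩ := exists_isApartMap_res R T
  have h1 := mt (hα.subset_of_preimage_subset ⟨b, hb⟩) h1
  have h2 := mt (hα.subset_of_preimage_subset ⟨a, ha⟩) h2
  rw [hα.preimage_res ha, hα.preimage_res hb] at h1 h2
  obtain ⟨K, c, hK, hbt, hR, hT⟩ :=
    CoxeterSystem.exists_halfSpaceBetween (sphType_resType R) (sphType_resType T) h2 h1
  let σ : X.Res := ⟨X.residue K (α c), K, α c, hK, rfl⟩
  have hσ : α ⁻¹' σ.1 = c • (cs.parabolic K : Set W) := hα.preimage_residue K c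
  rw [← hα.preimage_res ha, ← hσ] at hR hbt
  rw [← hα.preimage_res hb] at hT hbt
  rw [← hσ] at hT
  have hc : (α ⁻¹' σ.1).Nonempty := by
    rw [hσ]
    exact ⟨_, Set.smul_mem_smul_set (one_mem (cs.parabolic K))⟩
  refine ⟨σ, mem_interval_iff.2 ?_, fun h => hR (by rw [h]), fun h => hT (by rw [h])⟩
  rw [hα.sepNum_eq ⟨a, ha⟩ ⟨b, hb⟩, hα.sepNum_eq ⟨a, ha⟩ hc, hα.sepNum_eq hc ⟨b, hb⟩]
  exact hbt.ncard_add ⟨a, ha⟩ hc (hα.finite_preimage T) (hα.finite_preimage σ)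

theorem mem_interval_iff_of_leRes {R T σ : X.Res} (h : X.leRes R T) :
    σ ∈ X.interval R T ↔ X.leRes R σ ∧ X.leRes σ T := by
  rw [mem_interval_iff, sepNum_eq_zero_iff.2 h, ← sepNum_eq_zero_iff, ← sepNum_eq_zero_iff]
  omega

end Bldg

/-- the interval `[R₁,R₂]` equals `{R₁,R₂}` iff one of the two
residues contains the other and no residue other than `R₁,R₂` is sandwiched
between them. -/
theorem statement2 {cs : CoxeterSystem M W} (X : Bldg cs) (R₁ R₂ : X.Res) :
    X.interval R₁ R₂ = {R₁, R₂} ↔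
      (X.leRes R₁ R₂ ∨ X.leRes R₂ R₁) ∧
      ∀ R : X.Res, ((X.leRes R₁ R ∧ X.leRes R R₂) ∨ (X.leRes R₂ R ∧ X.leRes R R₁)) →
        R = R₁ ∨ R = R₂ := by
  constructor
  · intro h
    have hmem : ∀ R, X.leRes R₁ R ∧ X.leRes R R₂ ∨ X.leRes R₂ R ∧ X.leRes R R₁ →
        R ∈ X.interval R₁ R₂ := by
      rintro R (h1 | h1)
      · exact (Bldg.mem_interval_iff_of_leRes (h1.2.trans h1.1)).2 h1
      · rw [Bldg.interval_comm]
        exact (Bldg.mem_interval_iff_of_leRes (h1.2.trans h1.1)).2 h1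
    rw [h] at hmem
    refine ⟨?_, hmem⟩
    by_contra! hc
    obtain ⟨σ, hσ, h1, h2⟩ := Bldg.exists_mem_interval_ne hc.1 hc.2
    rw [h] at hσ
    exact hσ.elim h1 h2
  · rintro ⟨h1 | h1, h2⟩
    · ext σ
      rw [Bldg.mem_interval_iff_of_leRes h1]
      refine ⟨fun h => h2 σ (Or.inl h), ?_⟩
      rintro (rfl | rfl)
      · exact ⟨subset_rfl, h1⟩
      · exact ⟨h1, subset_rfl⟩
    · ext σ
      rw [Bldg.interval_comm, Bldg.mem_interval_iff_of_leRes h1]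
      refine ⟨fun h => h2 σ (Or.inr h), ?_⟩
      rintro (rfl | rfl)
      · exact ⟨h1, subset_rfl⟩
      · exact ⟨subset_rfl, h1⟩
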